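/- arXiv:1509.00988 — 3 statements merged into one kernel-verified Lean document; each statement's English description precedes it below -/
import Mathlib

section
/- Let C ⊆ NC°• be a category of noncrossing two-colored partitions and d = d(C). Then K^C(∘,•) = K^C(•,∘) = dℤ, and K^C(∘,∘) = −K^C(•,•). -/
noncomputable section
namespace CTCP

/-- Colors of points: `true` = white (∘), `false` = black (•). -/
abbrev Color := Bool

def white : Color := true
def black : Color := false

/-- A two-colored partition with `k` upper and `l` lower points.  The block
structure is recorded as a setoid on the disjoint union of the points. -/
structure TCP where
  k : ℕ
  l : ℕ
  upColor : Fin k → Color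
  lowColor : Fin l → Color
  rel : Setoid (Fin k ⊕ Fin l)

/-- The disjoint union of two equivalence relations. -/
def sumRel {α β : Type*} (r : Setoid α) (s : Setoid β) : (α ⊕ β) → (α ⊕ β) → Prop
  | .inl a, .inl b => r.r a b
  | .inr a, .inr b => s.r a b
  | _, _ => False

def sumSetoid {α β : Type*} (r : Setoid α) (s : Setoid β) : Setoid (α ⊕ β) where
  r := sumRel r s
  iseqv := by
    constructor
    · rintro (a | a)
      · exact r.iseqv.refl a
      · exact s.iseqv.refl a
    · rintro (a | a) (b | b) h
      · exact r.iseqv.symm h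
      · exact h.elim
      · exact h.elim
      · exact s.iseqv.symm h
    · rintro (a | a) (b | b) (c | c) h₁ h₂
      all_goals first
        | exact r.iseqv.trans h₁ h₂
        | exact s.iseqv.trans h₁ h₂
        | exact h₁.elim
        | exact h₂.elim

def splitPt (p q : TCP) :
    (Fin (p.k + q.k) ⊕ Fin (p.l + q.l)) → ((Fin p.k ⊕ Fin p.l) ⊕ (Fin q.k ⊕ Fin q.l))
  | .inl i => (finSumFinEquiv.symm i).elim (fun a => .inl (.inl a)) (fun b => .inr (.inl b))
  | .inr j => (finSumFinEquiv.symm j).elim (fun a => .inl (.inr a)) (fun b => .inr (.inr b))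

/-- Tensor product (horizontal concatenation) of two-colored partitions. -/
def tensor (p q : TCP) : TCP where
  k := p.k + q.k
  l := p.l + q.l
  upColor := fun i => (finSumFinEquiv.symm i).elim p.upColor q.upColor
  lowColor := fun j => (finSumFinEquiv.symm j).elim p.lowColor q.lowColor
  rel := Setoid.comap (splitPt p q) (sumSetoid p.rel q.rel)

def compEmbMid (q p : TCP) (h : q.l = p.k) :
    (Fin p.k ⊕ Fin p.l) → ((Fin q.k ⊕ Fin q.l) ⊕ Fin p.l)
  | .inl i => .inl (.inr (Fin.cast h.symm i))
  | .inr j => .inr j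

/-- The relation generating the blocks of the composition of `q` and `p`:
the blocks of `q` together with the blocks of `p`, glued along the middle row. -/
def compRel (q p : TCP) (h : q.l = p.k) :
    ((Fin q.k ⊕ Fin q.l) ⊕ Fin p.l) → ((Fin q.k ⊕ Fin q.l) ⊕ Fin p.l) → Prop :=
  fun t t' =>
    (∃ x y, q.rel.r x y ∧ t = .inl x ∧ t' = .inl y) ∨
    (∃ x y, p.rel.r x y ∧ t = compEmbMid q p h x ∧ t' = compEmbMid q p h y)

/-- Composition (vertical concatenation) of `q ∈ P(k,l)` with `p ∈ P(l,m)`: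
blocks are joined through the middle points, which are then deleted. -/
def comp (q p : TCP) (h : q.l = p.k) : TCP where
  k := q.k
  l := p.l
  upColor := q.upColor
  lowColor := p.lowColor
  rel := Setoid.comap
    (Sum.elim (fun i : Fin q.k => (Sum.inl (Sum.inl i) : (Fin q.k ⊕ Fin q.l) ⊕ Fin p.l))
      (fun j : Fin p.l => Sum.inr j))
    (Relation.EqvGen.setoid (compRel q p h))

/-- The colors of the lower row of `q` match the colors of the upper row of `p`. -/
def ColorsMatch (q p : TCP) (h : q.l = p.k) : Prop :=
  ∀ j : Fin q.l, q.lowColor j = p.upColor (Fin.cast h j)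

/-- Involution: reflection at the horizontal axis. -/
def invol (p : TCP) : TCP where
  k := p.l
  l := p.k
  upColor := p.lowColor
  lowColor := p.upColor
  rel := Setoid.comap Sum.swap p.rel

/-- Vertical reflection: reflection at the vertical axis. -/
def vref (p : TCP) : TCP where
  k := p.k
  l := p.l
  upColor := fun i => p.upColor i.rev
  lowColor := fun j => p.lowColor j.rev
  rel := Setoid.comap (Sum.map Fin.rev Fin.rev) p.rel

/-- Inversion of colors. -/
def cinv (p : TCP) : TCP where
  k := p.k
  l := p.l
  upColor := fun i => !(p.upColor i)
  lowColor := fun j => !(p.lowColor j)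
  rel := p.rel

/-- Verticolor reflection `p̃`: vertical reflection combined with color inversion. -/
def vcref (p : TCP) : TCP := cinv (vref p)

/-- Rotation of the leftmost upper point to the left end of the lower row
(inverting its color). -/
def rotULdown (p : TCP) (h : 0 < p.k) : TCP where
  k := p.k - 1
  l := p.l + 1
  upColor := fun i => p.upColor ⟨i.1 + 1, by have := i.2; omega⟩
  lowColor := fun j =>
    if hj : j.1 = 0 then !(p.upColor ⟨0, h⟩)
    else p.lowColor ⟨j.1 - 1, by have := j.2; omega⟩
  rel := Setoid.comap
    (Sum.elim
      (fun i : Fin (p.k - 1) => (Sum.inl ⟨i.1 + 1, by have := i.2; omega⟩ : Fin p.k ⊕ Fin p.l))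
      (fun j : Fin (p.l + 1) =>
        if hj : j.1 = 0 then Sum.inl ⟨0, h⟩
        else Sum.inr ⟨j.1 - 1, by have := j.2; omega⟩))
    p.rel

/-- Rotation of the rightmost upper point to the right end of the lower row
(inverting its color). -/
def rotURdown (p : TCP) (h : 0 < p.k) : TCP where
  k := p.k - 1
  l := p.l + 1
  upColor := fun i => p.upColor ⟨i.1, by have := i.2; omega⟩
  lowColor := fun j =>
    if hj : j.1 < p.l then p.lowColor ⟨j.1, hj⟩
    else !(p.upColor ⟨p.k - 1, by omega⟩)
  rel := Setoid.comap
    (Sum.elim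
      (fun i : Fin (p.k - 1) => (Sum.inl ⟨i.1, by have := i.2; omega⟩ : Fin p.k ⊕ Fin p.l))
      (fun j : Fin (p.l + 1) =>
        if hj : j.1 < p.l then Sum.inr ⟨j.1, hj⟩
        else Sum.inl ⟨p.k - 1, by omega⟩))
    p.rel

/-- Rotation of the leftmost lower point to the left end of the upper row
(inverting its color). -/
def rotULup (p : TCP) (h : 0 < p.l) : TCP where
  k := p.k + 1
  l := p.l - 1
  upColor := fun i =>
    if hi : i.1 = 0 then !(p.lowColor ⟨0, h⟩)
    else p.upColor ⟨i.1 - 1, by have := i.2; omega⟩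
  lowColor := fun j => p.lowColor ⟨j.1 + 1, by have := j.2; omega⟩
  rel := Setoid.comap
    (Sum.elim
      (fun i : Fin (p.k + 1) =>
        if hi : i.1 = 0 then (Sum.inr ⟨0, h⟩ : Fin p.k ⊕ Fin p.l)
        else Sum.inl ⟨i.1 - 1, by have := i.2; omega⟩)
      (fun j : Fin (p.l - 1) => Sum.inr ⟨j.1 + 1, by have := j.2; omega⟩))
    p.rel

/-- Rotation of the rightmost lower point to the right end of the upper row
(inverting its color). -/
def rotURup (p : TCP) (h : 0 < p.l) : TCP where
  k := p.k + 1
  l := p.l - 1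
  upColor := fun i =>
    if hi : i.1 < p.k then p.upColor ⟨i.1, hi⟩
    else !(p.lowColor ⟨p.l - 1, by omega⟩)
  lowColor := fun j => p.lowColor ⟨j.1, by have := j.2; omega⟩
  rel := Setoid.comap
    (Sum.elim
      (fun i : Fin (p.k + 1) =>
        if hi : i.1 < p.k then (Sum.inl ⟨i.1, hi⟩ : Fin p.k ⊕ Fin p.l)
        else Sum.inr ⟨p.l - 1, by omega⟩)
      (fun j : Fin (p.l - 1) => Sum.inr ⟨j.1, by have := j.2; omega⟩))
    p.rel

/-- `p'` is obtained from `p` by rotating an outermost point of one row to the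
corresponding end of the other row, inverting its color. -/
def IsRotationOf (p' p : TCP) : Prop :=
  (∃ h : 0 < p.k, p' = rotULdown p h) ∨ (∃ h : 0 < p.k, p' = rotURdown p h) ∨
  (∃ h : 0 < p.l, p' = rotULup p h) ∨ (∃ h : 0 < p.l, p' = rotURup p h)

/-- A partition with no upper points, given by colors and block labels. -/
def mkLower (n : ℕ) (color : Fin n → Color) (lbl : Fin n → ℕ) : TCP where
  k := 0
  l := n
  upColor := Fin.elim0
  lowColor := color
  rel := Setoid.ker (Sum.elim Fin.elim0 lbl)

/-- The identity partition of color `c`. -/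
def idPart (c : Color) : TCP where
  k := 1
  l := 1
  upColor := fun _ => c
  lowColor := fun _ => c
  rel := ⊤

/-- The pair partition on two lower points of colors `c₁`, `c₂`. -/
def pairLower (c₁ c₂ : Color) : TCP := mkLower 2 ![c₁, c₂] (fun _ => 0)

/-- The singleton of color `c`. -/
def singl (c : Color) : TCP := mkLower 1 (fun _ => c) (fun _ => 0)

/-- `bPart s` : one block on `s` white lower points (`bPart 0` is the empty partition). -/
def bPart (s : ℕ) : TCP := mkLower s (fun _ => white) (fun _ => 0)

/-- One block on four lower points with the given colors. -/
def fourBlock (c₁ c₂ c₃ c₄ : Color) : TCP := mkLower 4 ![c₁, c₂, c₃, c₄] (fun _ => 0)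

/-- The four-block ∘•∘•. -/
def fourWBWB : TCP := fourBlock white black white black

/-- The four-block ∘∘••. -/
def fourWWBB : TCP := fourBlock white white black black

/-- The empty partition. -/
def emptyPart : TCP := mkLower 0 Fin.elim0 Fin.elim0

/-- The partition ∘⊗• (a white and a black singleton). -/
def singPair : TCP := tensor (singl white) (singl black)

/-- The partition ∘∘⊗••. -/
def wwbb : TCP := tensor (pairLower white white) (pairLower black black)

/-- The crossing partition `X` on four white points: first upper point connected to the
second lower point, second upper point connected to the first lower point. -/
def crossPart : TCP where
  k := 2
  l := 2
  upColor := fun _ => white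
  lowColor := fun _ => white
  rel := Setoid.ker (Sum.elim (fun i : Fin 2 => (i.1 : ℕ)) (fun j : Fin 2 => 1 - j.1))

/-- `n`-fold tensor power. -/
def tensorPow (p : TCP) : ℕ → TCP
  | 0 => emptyPart
  | n + 1 => tensor (tensorPow p n) p

/-- The partition `p_d`: from left to right, `d` white singletons, a white point, `d` black
singletons and a black point, the two non-singleton points forming a pair block. -/
def pPart (d : ℕ) : TCP :=
  mkLower (2 * d + 2) (fun j => decide (j.1 ≤ d))
    (fun j => if j.1 = d ∨ j.1 = 2 * d + 1 then 0 else j.1 + 1)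

/-- The partition `p′_r`: from left to right, `r+1` white singletons, a black point, `r−1`
black singletons and a black point, the black non-singleton points forming a pair block;
for `r = 0` the middle consists of one white singleton instead. -/
def pPrime (r : ℕ) : TCP :=
  if r = 0 then
    mkLower 4 ![white, black, white, black]
      (fun j => if j.1 = 1 ∨ j.1 = 3 then 0 else j.1 + 1)
  else
    mkLower (2 * r + 2) (fun j => decide (j.1 ≤ r))
      (fun j => if j.1 = r + 1 ∨ j.1 = 2 * r + 1 then 0 else j.1 + 1)

/-- A category of two-colored partitions: a class of two-colored partitions closed under
tensor products, composition (when defined) and involution, containing both bicolored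
pair partitions and both identity partitions. -/
structure IsCategory (C : Set TCP) : Prop where
  tensor_mem : ∀ p ∈ C, ∀ q ∈ C, tensor p q ∈ C
  comp_mem : ∀ q ∈ C, ∀ p ∈ C, ∀ h : q.l = p.k, ColorsMatch q p h → comp q p h ∈ C
  invol_mem : ∀ p ∈ C, invol p ∈ C
  idw_mem : idPart white ∈ C
  idb_mem : idPart black ∈ C
  pairwb_mem : pairLower white black ∈ C
  pairbw_mem : pairLower black white ∈ C

/-- The smallest category of partitions containing `S`. -/
def generated (S : Set TCP) : Set TCP :=
  {p | ∀ C : Set TCP, IsCategory C → S ⊆ C → p ∈ C}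

/-- `c(p)` : (white lower points + black upper points) − (black lower points + white upper
points). -/
def cval (p : TCP) : ℤ :=
  ((Nat.card {j : Fin p.l // p.lowColor j = white} +
      Nat.card {i : Fin p.k // p.upColor i = black} : ℕ) : ℤ) -
    ((Nat.card {j : Fin p.l // p.lowColor j = black} +
      Nat.card {i : Fin p.k // p.upColor i = white} : ℕ) : ℤ)

/-- Position of a point on the line obtained by rotating all upper points down to the
left of the lower row. -/
def linePos (p : TCP) : (Fin p.k ⊕ Fin p.l) → ℕ :=
  Sum.elim (fun i => p.k - 1 - i.1) (fun j => p.k + j.1)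

/-- A partition is noncrossing if its strings can be drawn without crossings. -/
def Noncrossing (p : TCP) : Prop :=
  ∀ a b x y : Fin p.k ⊕ Fin p.l,
    linePos p a < linePos p b → linePos p b < linePos p x → linePos p x < linePos p y →
    p.rel.r a x → p.rel.r b y → p.rel.r a b

/-- The number of points in the block of the point `x`. -/
def blockSize (p : TCP) (x : Fin p.k ⊕ Fin p.l) : ℕ := Nat.card {y // p.rel.r x y}

/-- The partition obtained from `p` by rotating all upper points down, so that it has no
upper points. -/
def toLine (p : TCP) : TCP where
  k := 0
  l := p.k + p.l
  upColor := Fin.elim0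
  lowColor := fun j =>
    if hj : j.1 < p.k then !(p.upColor ⟨p.k - 1 - j.1, by omega⟩)
    else p.lowColor ⟨j.1 - p.k, by have := j.2; omega⟩
  rel := Setoid.comap
    (Sum.elim (fun i : Fin 0 => (Fin.elim0 i : Fin p.k ⊕ Fin p.l))
      (fun j : Fin (p.k + p.l) =>
        if hj : j.1 < p.k then Sum.inl ⟨p.k - 1 - j.1, by omega⟩
        else Sum.inr ⟨j.1 - p.k, by have := j.2; omega⟩))
    p.rel

def eraseLowRel (p : TCP) (j : ℕ) (hj : j + 1 < p.l) :
    (Fin p.k ⊕ Fin p.l) → (Fin p.k ⊕ Fin p.l) → Prop :=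
  fun x y => p.rel.r x y ∨ (x = Sum.inr ⟨j, by omega⟩ ∧ y = Sum.inr ⟨j + 1, hj⟩)

/-- Erasing the `j`-th and `(j+1)`-th lower points of `p`, first joining their blocks. -/
def eraseLowerPair (p : TCP) (j : ℕ) (hj : j + 1 < p.l) : TCP where
  k := p.k
  l := p.l - 2
  upColor := p.upColor
  lowColor := fun m =>
    if hm : m.1 < j then p.lowColor ⟨m.1, by omega⟩
    else p.lowColor ⟨m.1 + 2, by have := m.2; omega⟩
  rel := Setoid.comap
    (Sum.elim (fun i : Fin p.k => (Sum.inl i : Fin p.k ⊕ Fin p.l))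
      (fun m : Fin (p.l - 2) =>
        if hm : m.1 < j then Sum.inr ⟨m.1, by omega⟩
        else Sum.inr ⟨m.1 + 2, by have := m.2; omega⟩))
    (Relation.EqvGen.setoid (eraseLowRel p j hj))

def eraseUpRel (p : TCP) (j : ℕ) (hj : j + 1 < p.k) :
    (Fin p.k ⊕ Fin p.l) → (Fin p.k ⊕ Fin p.l) → Prop :=
  fun x y => p.rel.r x y ∨ (x = Sum.inl ⟨j, by omega⟩ ∧ y = Sum.inl ⟨j + 1, hj⟩)

/-- Erasing the `j`-th and `(j+1)`-th upper points of `p`, first joining their blocks. -/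
def eraseUpperPair (p : TCP) (j : ℕ) (hj : j + 1 < p.k) : TCP where
  k := p.k - 2
  l := p.l
  upColor := fun m =>
    if hm : m.1 < j then p.upColor ⟨m.1, by omega⟩
    else p.upColor ⟨m.1 + 2, by have := m.2; omega⟩
  lowColor := p.lowColor
  rel := Setoid.comap
    (Sum.elim
      (fun m : Fin (p.k - 2) =>
        if hm : m.1 < j then (Sum.inl ⟨m.1, by omega⟩ : Fin p.k ⊕ Fin p.l)
        else Sum.inl ⟨m.1 + 2, by have := m.2; omega⟩)
      (fun i : Fin p.l => Sum.inr i))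
    (Relation.EqvGen.setoid (eraseUpRel p j hj))

/-- `p₁ ⊗ p₂ ∈ C` is in nest decomposed form, with the first point of `p₂` colored `x`
and the last point of `p₂` colored `y` (and those two points in the same block). -/
def InNDF (C : Set TCP) (x y : Color) (p₁ p₂ : TCP) : Prop :=
  tensor p₁ p₂ ∈ C ∧ Noncrossing (tensor p₁ p₂) ∧ p₁.k = 0 ∧ p₂.k = 0 ∧ 0 < p₁.l ∧
    ∃ h : 2 ≤ p₂.l,
      p₂.lowColor ⟨0, by omega⟩ = x ∧ p₂.lowColor ⟨p₂.l - 1, by omega⟩ = y ∧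
      p₂.rel.r (Sum.inr ⟨0, by omega⟩) (Sum.inr ⟨p₂.l - 1, by omega⟩)

/-- `K^C(x,y)`: the set of values `c(p₁)` over nest decomposed forms `p₁ ⊗ p₂ ∈ C` whose
outer block starts with color `x` and ends with color `y`. -/
def Kset (C : Set TCP) (x y : Color) : Set ℤ :=
  {n | ∃ p₁ p₂, InNDF C x y p₁ p₂ ∧ cval p₁ = n}

/-- The degree of reflection `k(C)`. -/
def kdeg (C : Set TCP) : ℕ := sInf {n : ℕ | 0 < n ∧ ∃ p ∈ C, cval p = (n : ℤ)}

/-- The local parameter `d(C)`. -/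
def ddeg (C : Set TCP) : ℕ := sInf {n : ℕ | 0 < n ∧ (n : ℤ) ∈ Kset C white black}

/-- The local parameter `r(C) = min {t ≥ 1 | t ∈ K^C(•,•)} − 1`. -/
def rdeg (C : Set TCP) : ℕ := sInf {t : ℕ | 1 ≤ t ∧ (t : ℤ) ∈ Kset C black black} - 1

/-- `C` is globally colorized if it contains `∘∘ ⊗ ••`. -/
def GloballyColorized (C : Set TCP) : Prop := wwbb ∈ C

def CaseO (C : Set TCP) : Prop := singPair ∉ C ∧ fourWBWB ∉ C
def CaseB (C : Set TCP) : Prop := singPair ∈ C ∧ fourWBWB ∉ C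
def CaseH (C : Set TCP) : Prop := singPair ∉ C ∧ fourWBWB ∈ C
def CaseS (C : Set TCP) : Prop := singPair ∈ C ∧ fourWBWB ∈ C

/-! Non-colored partitions. -/

/-- A non-colored partition with `k` upper and `l` lower points. -/
structure NCP where
  k : ℕ
  l : ℕ
  rel : Setoid (Fin k ⊕ Fin l)

namespace NCP

def splitPt (p q : NCP) :
    (Fin (p.k + q.k) ⊕ Fin (p.l + q.l)) → ((Fin p.k ⊕ Fin p.l) ⊕ (Fin q.k ⊕ Fin q.l))
  | .inl i => (finSumFinEquiv.symm i).elim (fun a => .inl (.inl a)) (fun b => .inr (.inl b))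
  | .inr j => (finSumFinEquiv.symm j).elim (fun a => .inl (.inr a)) (fun b => .inr (.inr b))

def tensor (p q : NCP) : NCP where
  k := p.k + q.k
  l := p.l + q.l
  rel := Setoid.comap (splitPt p q) (sumSetoid p.rel q.rel)

def compEmbMid (q p : NCP) (h : q.l = p.k) :
    (Fin p.k ⊕ Fin p.l) → ((Fin q.k ⊕ Fin q.l) ⊕ Fin p.l)
  | .inl i => .inl (.inr (Fin.cast h.symm i))
  | .inr j => .inr j

def compRel (q p : NCP) (h : q.l = p.k) :
    ((Fin q.k ⊕ Fin q.l) ⊕ Fin p.l) → ((Fin q.k ⊕ Fin q.l) ⊕ Fin p.l) → Prop :=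
  fun t t' =>
    (∃ x y, q.rel.r x y ∧ t = .inl x ∧ t' = .inl y) ∨
    (∃ x y, p.rel.r x y ∧ t = compEmbMid q p h x ∧ t' = compEmbMid q p h y)

def comp (q p : NCP) (h : q.l = p.k) : NCP where
  k := q.k
  l := p.l
  rel := Setoid.comap
    (Sum.elim (fun i : Fin q.k => (Sum.inl (Sum.inl i) : (Fin q.k ⊕ Fin q.l) ⊕ Fin p.l))
      (fun j : Fin p.l => Sum.inr j))
    (Relation.EqvGen.setoid (compRel q p h))

def invol (p : NCP) : NCP where
  k := p.l
  l := p.k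
  rel := Setoid.comap Sum.swap p.rel

/-- The non-colored identity partition. -/
def idN : NCP := ⟨1, 1, ⊤⟩

/-- The non-colored pair partition on two lower points. -/
def pairN : NCP := ⟨0, 2, ⊤⟩

end NCP

/-- A category of non-colored partitions. -/
structure IsCategoryN (D : Set NCP) : Prop where
  tensor_mem : ∀ p ∈ D, ∀ q ∈ D, NCP.tensor p q ∈ D
  comp_mem : ∀ q ∈ D, ∀ p ∈ D, ∀ h : q.l = p.k, NCP.comp q p h ∈ D
  invol_mem : ∀ p ∈ D, NCP.invol p ∈ D
  id_mem : NCP.idN ∈ D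
  pair_mem : NCP.pairN ∈ D

/-- The map `Ψ` forgetting the colors of a two-colored partition. -/
def forget (p : TCP) : NCP := ⟨p.k, p.l, p.rel⟩

/-! ### Partitions presented by lists of colored labels -/

/-- The two-colored partition whose rows are given by lists of pairs of a color and a block
label; two points are in the same block iff they carry the same label. -/
def ofLists {α : Type} (u l : List (Color × α)) : TCP where
  k := u.length
  l := l.length
  upColor := fun i => (u.get i).1
  lowColor := fun j => (l.get j).1
  rel := Setoid.ker (Sum.elim (fun i => (u.get i).2) (fun j => (l.get j).2))

/-- Apply a function to all labels of a list of colored labels. -/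
def mapLabel {α β : Type} (f : α → β) (l : List (Color × α)) : List (Color × β) :=
  l.map (Prod.map id f)

@[simp] lemma mapLabel_nil {α β : Type} (f : α → β) : mapLabel f [] = [] := rfl

@[simp] lemma mapLabel_cons {α β : Type} (f : α → β) (s : Color × α) (l : List (Color × α)) :
    mapLabel f (s :: l) = (s.1, f s.2) :: mapLabel f l := rfl

@[simp] lemma mapLabel_append {α β : Type} (f : α → β) (l l' : List (Color × α)) :
    mapLabel f (l ++ l') = mapLabel f l ++ mapLabel f l' := by simp [mapLabel]

@[simp] lemma mapLabel_mapLabel {α β γ : Type} (f : α → β) (g : β → γ) (l : List (Color × α)) :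
    mapLabel g (mapLabel f l) = mapLabel (g ∘ f) l := by simp [mapLabel]

lemma mapLabel_eq_self {α : Type} {f : α → α} {l : List (Color × α)}
    (h : ∀ s ∈ l, f s.2 = s.2) : mapLabel f l = l := by
  induction l with
  | nil => rfl
  | cons s l ih =>
    simp only [List.mem_cons, forall_eq_or_imp] at h
    simp [ih h.2, h.1]

lemma mem_mapLabel {α β : Type} {f : α → β} {l : List (Color × α)} {t : Color × β} :
    t ∈ mapLabel f l ↔ ∃ s ∈ l, (s.1, f s.2) = t := by
  simp [mapLabel, Prod.map]

lemma eq_ofLists {α : Type} {p : TCP} {u l : List (Color × α)}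
    (lab : Fin p.k ⊕ Fin p.l → α) (hr : ∀ x y, p.rel.r x y ↔ lab x = lab y)
    (hk : u.length = p.k) (hl : l.length = p.l)
    (hu : ∀ (i : ℕ) (h : i < u.length) (h' : i < p.k),
      u[i] = (p.upColor ⟨i, h'⟩, lab (Sum.inl ⟨i, h'⟩)))
    (hc : ∀ (i : ℕ) (h : i < l.length) (h' : i < p.l),
      l[i] = (p.lowColor ⟨i, h'⟩, lab (Sum.inr ⟨i, h'⟩))) :
    p = ofLists u l := by
  obtain ⟨k, m, cu, cl, r⟩ := p
  dsimp only at hk hl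
  subst hk hl
  have h1 : cu = fun i => (u.get i).1 := by
    funext i; exact (congrArg Prod.fst (hu i.1 i.2 i.2)).symm
  have h2 : cl = fun i => (l.get i).1 := by
    funext i; exact (congrArg Prod.fst (hc i.1 i.2 i.2)).symm
  have h3 : lab = Sum.elim (fun i => (u.get i).2) (fun j => (l.get j).2) := by
    funext x
    rcases x with i | i
    · exact (congrArg Prod.snd (hu i.1 i.2 i.2)).symm
    · exact (congrArg Prod.snd (hc i.1 i.2 i.2)).symm
  have h4 : r = Setoid.ker (Sum.elim (fun i => (u.get i).2) (fun j => (l.get j).2)) := by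
    rw [← h3]
    ext x y
    exact hr x y
  rw [ofLists, h1, h2, h4]

lemma ofLists_mapLabel {α β : Type} (f : α → β) (u l : List (Color × α))
    (hf : ∀ s ∈ u ++ l, ∀ t ∈ u ++ l, f s.2 = f t.2 → s.2 = t.2) :
    ofLists (mapLabel f u) (mapLabel f l) = ofLists u l := by
  have key : ∀ x : Fin u.length ⊕ Fin l.length, ∃ s ∈ u ++ l,
      Sum.elim (fun i => (u.get i).2) (fun j => (l.get j).2) x = s.2 := by
    rintro (i | j)
    · exact ⟨u.get i, by simp, rfl⟩
    · exact ⟨l.get j, by simp, rfl⟩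
  symm
  refine eq_ofLists (fun x => f (Sum.elim (fun i => (u.get i).2) (fun j => (l.get j).2) x))
    ?_ (by simp [ofLists, mapLabel]) (by simp [ofLists, mapLabel]) ?_ ?_
  · intro x y
    obtain ⟨s, hs, es⟩ := key x
    obtain ⟨t, ht, et⟩ := key y
    refine Iff.trans (b := s.2 = t.2) ?_ ?_
    · rw [← es, ← et]; rfl
    · simp only [es, et]
      exact ⟨congrArg f, hf s hs t ht⟩
  · intro i _ _
    simp only [mapLabel, List.getElem_map]
    rfl
  · intro i _ _
    simp only [mapLabel, List.getElem_map]
    rfl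

lemma getElem_append_mapLabel {α β : Type} (l : List (Color × α)) (l' : List (Color × β))
    (i : ℕ) (hi : i < (mapLabel (Sum.inl : α → α ⊕ β) l ++ mapLabel Sum.inr l').length)
    (hi' : i < l.length + l'.length) :
    (mapLabel (Sum.inl : α → α ⊕ β) l ++ mapLabel Sum.inr l')[i] =
      Sum.elim (fun a => ((l.get a).1, Sum.inl (l.get a).2))
        (fun b => ((l'.get b).1, Sum.inr (l'.get b).2)) (finSumFinEquiv.symm ⟨i, hi'⟩) := by
  obtain ⟨j, hj⟩ : ∃ j : Fin (l.length + l'.length), j = ⟨i, hi'⟩ := ⟨_, rfl⟩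
  obtain rfl : j.1 = i := by rw [hj]
  rw [← hj]
  clear hj
  induction j using Fin.addCases with
  | left a => simp [mapLabel, Prod.map]
  | right b => simp [mapLabel, Prod.map]

lemma tensor_ofLists {α β : Type} (u l : List (Color × α)) (u' l' : List (Color × β)) :
    tensor (ofLists u l) (ofLists u' l') =
      ofLists (mapLabel Sum.inl u ++ mapLabel Sum.inr u')
        (mapLabel Sum.inl l ++ mapLabel Sum.inr l') := by
  refine eq_ofLists (fun z =>
    Sum.elim (fun t => Sum.inl (Sum.elim (fun i => (u.get i).2) (fun j => (l.get j).2) t))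
      (fun t => Sum.inr (Sum.elim (fun i => (u'.get i).2) (fun j => (l'.get j).2) t))
      (splitPt (ofLists u l) (ofLists u' l') z)) ?_ (by simp [mapLabel, ofLists, tensor])
      (by simp [mapLabel, ofLists, tensor]) ?_ ?_
  · intro x y
    change sumRel _ _ (splitPt (ofLists u l) (ofLists u' l') x)
      (splitPt (ofLists u l) (ofLists u' l') y) ↔ _ = _
    rcases splitPt (ofLists u l) (ofLists u' l') x with a | a <;>
    rcases splitPt (ofLists u l) (ofLists u' l') y with b | b
    · exact ⟨fun h => congrArg Sum.inl h, fun h => Sum.inl_injective h⟩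
    · exact ⟨fun h => h.elim, fun h => absurd h Sum.inl_ne_inr⟩
    · exact ⟨fun h => h.elim, fun h => absurd h Sum.inr_ne_inl⟩
    · exact ⟨fun h => congrArg Sum.inr h, fun h => Sum.inr_injective h⟩
  · intro i hi hi'
    rw [getElem_append_mapLabel _ _ _ _ hi']
    dsimp only [tensor, ofLists, splitPt]
    cases finSumFinEquiv.symm (⟨i, hi'⟩ : Fin (u.length + u'.length)) <;> rfl
  · intro i hi hi'
    rw [getElem_append_mapLabel _ _ _ _ hi']
    dsimp only [tensor, ofLists, splitPt]
    cases finSumFinEquiv.symm (⟨i, hi'⟩ : Fin (l.length + l'.length)) <;> rfl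

lemma invol_ofLists {α : Type} (u l : List (Color × α)) :
    invol (ofLists u l) = ofLists l u :=
  eq_ofLists (fun x => Sum.elim (fun i => (u.get i).2) (fun j => (l.get j).2) x.swap)
    (fun _ _ => Iff.rfl) rfl rfl (fun _ _ _ => rfl) (fun _ _ _ => rfl)

lemma exists_ofLists (p : TCP) : ∃ (α : Type) (u l : List (Color × α)), p = ofLists u l :=
  ⟨Quotient p.rel, List.ofFn fun i => (p.upColor i, Quotient.mk _ (Sum.inl i)),
    List.ofFn fun j => (p.lowColor j, Quotient.mk _ (Sum.inr j)),
    eq_ofLists (Quotient.mk _) (fun _ _ => (Quotient.eq (r := p.rel)).symm) (by simp) (by simp)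
      (fun _ _ _ => by simp) (fun _ _ _ => by simp)⟩

lemma idPart_eq (c : Color) : idPart c = ofLists [(c, ())] [(c, ())] :=
  eq_ofLists (fun _ => ()) (fun _ _ => ⟨fun _ => rfl, fun _ => trivial⟩) rfl rfl
    (fun _ _ _ => by simp [idPart]) (fun _ _ _ => by simp [idPart])

lemma pairLower_eq (c d : Color) : pairLower c d = ofLists [] [(c, ()), (d, ())] := by
  refine eq_ofLists (fun _ => ()) ?_ rfl rfl (fun _ h _ => by simp at h) ?_
  · rintro (i | i) (j | j)
    · exact i.elim0
    · exact i.elim0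
    · exact j.elim0
    · exact ⟨fun _ => rfl, fun _ => rfl⟩
  · intro i h _
    rcases i with _ | _ | i
    · rfl
    · rfl
    · simp at h

/-! ### Composition of partitions presented by lists -/

/-- The gluing of labels along the middle row of a composition. -/
def glue {α β : Type} (l : List (Color × α)) (u : List (Color × β)) (x y : α ⊕ β) : Prop :=
  ∃ t ∈ l.zip u, x = Sum.inl t.1.2 ∧ y = Sum.inr t.2.2

/-- The point `t` of a composition lies in a block with label `x`. -/
def HasLabel {α β : Type} (u l : List (Color × α)) (u' l' : List (Color × β))
    (h : l.length = u'.length) :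
    α ⊕ β → ((Fin u.length ⊕ Fin l.length) ⊕ Fin l'.length) → Prop
  | .inl a, .inl (.inl i) => (u.get i).2 = a
  | .inl a, .inl (.inr i) => (l.get i).2 = a
  | .inr b, .inl (.inr i) => (u'.get (Fin.cast h i)).2 = b
  | .inr b, .inr i => (l'.get i).2 = b
  | _, _ => False

lemma eqvGen_of_hasLabel {α β : Type} {u l : List (Color × α)} {u' l' : List (Color × β)}
    (h : l.length = u'.length) (x : α ⊕ β)
    (t t' : (Fin u.length ⊕ Fin l.length) ⊕ Fin l'.length)
    (ht : HasLabel u l u' l' h x t) (ht' : HasLabel u l u' l' h x t') :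
    Relation.EqvGen (compRel (ofLists u l) (ofLists u' l') h) t t' := by
  apply Relation.EqvGen.rel
  rcases x with a | b
  · left
    rcases t with (i | i) | i <;> rcases t' with (j | j) | j <;>
      first
        | exact ht.elim
        | exact ht'.elim
        | exact ⟨_, _, ht.trans ht'.symm, rfl, rfl⟩
  · right
    rcases t with (i | i) | i <;> rcases t' with (j | j) | j <;>
      first
        | exact ht.elim
        | exact ht'.elim
        | skip
    · exact ⟨Sum.inl (Fin.cast h i), Sum.inl (Fin.cast h j), ht.trans ht'.symm, rfl, rfl⟩
    · exact ⟨Sum.inl (Fin.cast h i), Sum.inr j, ht.trans ht'.symm, rfl, rfl⟩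
    · exact ⟨Sum.inr i, Sum.inl (Fin.cast h j), ht.trans ht'.symm, rfl, rfl⟩
    · exact ⟨Sum.inr i, Sum.inr j, ht.trans ht'.symm, rfl, rfl⟩

lemma eqvGen_of_glue {α β : Type} {u l : List (Color × α)} {u' l' : List (Color × β)}
    (h : l.length = u'.length) {x y : α ⊕ β} (hxy : Relation.EqvGen (glue l u') x y) :
    x = y ∨ ((∃ t, HasLabel u l u' l' h x t) ∧ (∃ t, HasLabel u l u' l' h y t) ∧
      ∀ t t', HasLabel u l u' l' h x t → HasLabel u l u' l' h y t' →
        Relation.EqvGen (compRel (ofLists u l) (ofLists u' l') h) t t') := by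
  induction hxy with
  | rel x y hxy =>
    right
    obtain ⟨s, hs, rfl, rfl⟩ := hxy
    obtain ⟨i, hi, rfl⟩ := List.mem_iff_getElem.1 hs
    have hi' : i < l.length := by
      rw [List.length_zip] at hi; omega
    have h1 : HasLabel u l u' l' h (Sum.inl (l.zip u')[i].1.2) (Sum.inl (Sum.inr ⟨i, hi'⟩)) := by
      simp [HasLabel]
    have h2 : HasLabel u l u' l' h (Sum.inr (l.zip u')[i].2.2) (Sum.inl (Sum.inr ⟨i, hi'⟩)) := by
      simp [HasLabel]
    exact ⟨⟨_, h1⟩, ⟨_, h2⟩, fun t t' ht ht' =>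
      (eqvGen_of_hasLabel h _ _ _ ht h1).trans _ _ _ (eqvGen_of_hasLabel h _ _ _ h2 ht')⟩
  | refl x => exact Or.inl rfl
  | symm x y _ ih =>
    rcases ih with rfl | ⟨h1, h2, h3⟩
    · exact Or.inl rfl
    · exact Or.inr ⟨h2, h1, fun t t' ht ht' => (h3 t' t ht' ht).symm⟩
  | trans x y z _ _ ih ih' =>
    rcases ih with rfl | ⟨h1, h2, h3⟩
    · exact ih'
    · rcases ih' with rfl | ⟨h1', h2', h3'⟩
      · exact Or.inr ⟨h1, h2, h3⟩
      · obtain ⟨s, hs⟩ := h2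
        exact Or.inr ⟨h1, h2', fun t t' ht ht' => (h3 t s ht hs).trans _ _ _ (h3' s t' hs ht')⟩

/-- Composition in terms of labels: the functions `f` and `g` compute the final labels, and `r`
selects representatives of the classes of glued labels. -/
lemma comp_ofLists {α β γ : Type} {u l : List (Color × α)} {u' l' : List (Color × β)}
    (h : l.length = u'.length) (f : α → γ) (g : β → γ) (r : γ → α ⊕ β)
    (hfg : ∀ t ∈ l.zip u', f t.1.2 = g t.2.2)
    (hf : ∀ t ∈ u, Relation.EqvGen (glue l u') (Sum.inl t.2) (r (f t.2)))
    (hg : ∀ t ∈ l', Relation.EqvGen (glue l u') (Sum.inr t.2) (r (g t.2))) :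
    comp (ofLists u l) (ofLists u' l') h = ofLists (mapLabel f u) (mapLabel g l') := by
  have hmid : ∀ i : Fin l.length, f (l.get i).2 = g (u'.get (Fin.cast h i)).2 := by
    intro i
    have hi : i.1 < (l.zip u').length := by rw [List.length_zip]; omega
    have := hfg _ (List.getElem_mem hi)
    simpa using this
  -- final label of a point
  let F : ((Fin u.length ⊕ Fin l.length) ⊕ Fin l'.length) → γ :=
    Sum.elim (Sum.elim (fun i => f (u.get i).2) (fun i => f (l.get i).2))
      (fun i => g (l'.get i).2)
  have hF : ∀ t t', Relation.EqvGen (compRel (ofLists u l) (ofLists u' l') h) t t' →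
      F t = F t' := by
    intro t t' htt'
    induction htt' with
    | rel t t' htt' =>
      rcases htt' with ⟨x, y, hxy, rfl, rfl⟩ | ⟨x, y, hxy, rfl, rfl⟩
      · have := congrArg f hxy
        rcases x with i | i <;> rcases y with j | j <;> exact this
      · have := congrArg g hxy
        have hm : ∀ z : Fin u'.length ⊕ Fin l'.length,
            F (compEmbMid (ofLists u l) (ofLists u' l') h z) =
              g (Sum.elim (fun i => (u'.get i).2) (fun j => (l'.get j).2) z) := by
          rintro (i | i)
          · exact hmid (Fin.cast h.symm i)
          · rfl
        exact (hm x).trans (this.trans (hm y).symm)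
    | refl t => rfl
    | symm _ _ _ ih => exact ih.symm
    | trans _ _ _ _ _ ih ih' => exact ih.trans ih'
  have hrep : ∀ (z : Fin u.length ⊕ Fin l'.length),
      ∃ x, HasLabel u l u' l' h x (Sum.elim (fun i => Sum.inl (Sum.inl i)) Sum.inr z) ∧
        Relation.EqvGen (glue l u') x
          (r (F (Sum.elim (fun i => Sum.inl (Sum.inl i)) Sum.inr z))) := by
    rintro (i | i)
    · exact ⟨Sum.inl (u.get i).2, rfl, hf _ (List.get_mem _ _)⟩
    · exact ⟨Sum.inr (l'.get i).2, rfl, hg _ (List.get_mem _ _)⟩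
  refine eq_ofLists (fun z => F (Sum.elim (fun i => Sum.inl (Sum.inl i)) Sum.inr z)) ?_
    (by simp [mapLabel, comp, ofLists]) (by simp [mapLabel, comp, ofLists]) ?_ ?_
  · intro x y
    refine ⟨fun hxy => hF _ _ hxy, fun hxy => ?_⟩
    obtain ⟨a, ha, ha'⟩ := hrep x
    obtain ⟨b, hb, hb'⟩ := hrep y
    have hr : r (F (Sum.elim (fun i => Sum.inl (Sum.inl i)) Sum.inr y)) =
        r (F (Sum.elim (fun i => Sum.inl (Sum.inl i)) Sum.inr x)) := congrArg r hxy.symm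
    rw [hr] at hb'
    rcases eqvGen_of_glue h (ha'.trans _ _ _ hb'.symm) with rfl | ⟨-, -, hab⟩
    · exact eqvGen_of_hasLabel h _ _ _ ha hb
    · exact hab _ _ ha hb
  · intro i _ _
    simp only [mapLabel, List.getElem_map]
    rfl
  · intro i _ _
    simp only [mapLabel, List.getElem_map]
    rfl

/-! ### Closure properties of categories in terms of lists -/

lemma IsCategory.tensor_ofLists {C : Set TCP} (hC : IsCategory C) {α β : Type}
    {u l : List (Color × α)} {u' l' : List (Color × β)}
    (h : ofLists u l ∈ C) (h' : ofLists u' l' ∈ C) :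
    ofLists (mapLabel (Sum.inl : α → α ⊕ β) u ++ mapLabel Sum.inr u')
      (mapLabel Sum.inl l ++ mapLabel Sum.inr l') ∈ C := by
  rw [← CTCP.tensor_ofLists]
  exact hC.tensor_mem _ h _ h'

lemma IsCategory.comp_ofLists {C : Set TCP} (hC : IsCategory C) {α β γ : Type}
    {u l : List (Color × α)} {u' l' : List (Color × β)}
    (hq : ofLists u l ∈ C) (hp : ofLists u' l' ∈ C) (hcol : l.map Prod.fst = u'.map Prod.fst)
    (f : α → γ) (g : β → γ) (r : γ → α ⊕ β)
    (hfg : ∀ t ∈ l.zip u', f t.1.2 = g t.2.2)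
    (hf : ∀ t ∈ u, Relation.EqvGen (glue l u') (Sum.inl t.2) (r (f t.2)))
    (hg : ∀ t ∈ l', Relation.EqvGen (glue l u') (Sum.inr t.2) (r (g t.2))) :
    ofLists (mapLabel f u) (mapLabel g l') ∈ C := by
  have h : l.length = u'.length := by simpa using congrArg List.length hcol
  rw [← CTCP.comp_ofLists h f g r hfg hf hg]
  refine hC.comp_mem _ hq _ hp h fun j => ?_
  have := List.getElem_of_eq hcol (i := j.1) (by rw [List.length_map]; exact j.2)
  simp only [List.getElem_map] at this
  exact this

lemma IsCategory.id_mem {C : Set TCP} (hC : IsCategory C) (c : Color) :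
    ofLists [(c, ())] [(c, ())] ∈ C := by
  rw [← idPart_eq]
  cases c
  · exact hC.idb_mem
  · exact hC.idw_mem

lemma IsCategory.pair_mem {C : Set TCP} (hC : IsCategory C) (c : Color) :
    ofLists [] [(c, ()), (!c, ())] ∈ C := by
  rw [← pairLower_eq]
  cases c
  · exact hC.pairbw_mem
  · exact hC.pairwb_mem

/-- The labels of a list, made pairwise distinct by recording the position. -/
def strands {α : Type} (u : List (Color × α)) : List (Color × ((Color × α) × ℕ)) :=
  u.zipIdx.map fun t => (t.1.1, t)

lemma map_eq_map_zipIdx {α β : Type} (f : α → β) (u : List α) :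
    u.map f = u.zipIdx.map fun t => f t.1 := by
  conv_lhs => rw [← List.zipIdx_map_fst 0 u, List.map_map]
  rfl

lemma map_fst_strands {α : Type} (u : List (Color × α)) :
    (strands u).map Prod.fst = u.map Prod.fst := by
  rw [map_eq_map_zipIdx _ u, strands, List.map_map]
  rfl

lemma mapLabel_strands {α β : Type} (f : α → β) (u : List (Color × α)) :
    mapLabel (fun t => f t.1.2) (strands u) = mapLabel f u := by
  rw [mapLabel, mapLabel, map_eq_map_zipIdx (Prod.map id f), strands, List.map_map]
  rfl

lemma zip_strands {α β γ : Type} (f : ((Color × α) × ℕ) → β) (g : α → γ) (u : List (Color × α)) :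
    (mapLabel f (strands u)).zip (mapLabel g u) =
      u.zipIdx.map fun t => ((t.1.1, f t), (t.1.1, g t.1.2)) := by
  have : mapLabel g u = u.zipIdx.map fun t => (t.1.1, g t.1.2) := by
    rw [mapLabel, map_eq_map_zipIdx]
    rfl
  rw [this, strands, mapLabel, List.map_map, List.zip_map']
  rfl

lemma IsCategory.strands_mem {C : Set TCP} (hC : IsCategory C) {α : Type}
    (u : List (Color × α)) : ofLists (strands u) (strands u) ∈ C := by
  induction u using List.reverseRecOn with
  | nil =>
    have h1 := hC.pair_mem true
    have h2 := hC.invol_mem _ h1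
    rw [invol_ofLists] at h2
    have := hC.comp_ofLists h1 h2 rfl (fun _ => ()) (fun _ => ()) Sum.inl
      (by simp) (by simp) (by simp)
    have e : ofLists (mapLabel (fun _ : Unit => ()) []) (mapLabel (fun _ : Unit => ()) []) =
        ofLists (strands ([] : List (Color × α))) (strands []) :=
      eq_ofLists (Sum.elim (fun i => i.elim0) (fun i => i.elim0))
        (by rintro (i | i) <;> exact i.elim0) rfl rfl
        (fun _ h => by simp [strands] at h) (fun _ h => by simp [strands] at h)
    rwa [e] at this
  | append_singleton u s ih =>
    have h := hC.tensor_ofLists ih (hC.id_mem s.1)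
    rw [← ofLists_mapLabel (Sum.elim id fun _ => (s, u.length))] at h
    · have e : mapLabel (Sum.elim id fun _ => (s, u.length))
          (mapLabel Sum.inl (strands u) ++ mapLabel (Sum.inr : Unit → _) [(s.1, ())]) =
          strands (u ++ [s]) := by
        simp [strands, List.zipIdx_append, mapLabel]
      rwa [e] at h
    · have key : ∀ x ∈ mapLabel Sum.inl (strands u) ++ mapLabel (Sum.inr : Unit → _) [(s.1, ())],
          x.2 = Sum.inr () ∨ ∃ t : (Color × α) × ℕ, x.2 = Sum.inl t ∧ t.2 < u.length := by
        intro x hx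
        simp only [mapLabel_cons, mapLabel_nil, List.mem_append, List.mem_singleton] at hx
        rcases hx with hx | rfl
        · right
          simp only [strands, mapLabel, List.map_map, List.mem_map] at hx
          obtain ⟨t, ht, rfl⟩ := hx
          exact ⟨t, rfl, by simpa using List.snd_lt_of_mem_zipIdx ht⟩
        · exact Or.inl rfl
      intro x hx y hy hxy
      have hx' : x ∈ mapLabel Sum.inl (strands u) ++ mapLabel (Sum.inr : Unit → _) [(s.1, ())] := by
        rcases List.mem_append.1 hx with h | h <;> exact h
      have hy' : y ∈ mapLabel Sum.inl (strands u) ++ mapLabel (Sum.inr : Unit → _) [(s.1, ())] := by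
        rcases List.mem_append.1 hy with h | h <;> exact h
      rcases key x hx' with ex | ⟨t, ex, ht⟩ <;> rcases key y hy' with ey | ⟨t', ey, ht'⟩
      · rw [ex, ey]
      · rw [ex, ey] at hxy
        rw [← (show (s, u.length) = t' from hxy)] at ht'
        simp at ht'
      · rw [ex, ey] at hxy
        rw [(show t = (s, u.length) from hxy)] at ht
        simp at ht
      · rw [ex, ey] at hxy ⊢
        exact congrArg Sum.inl hxy

/-- Rotation of the leftmost upper point to the lower row. -/
lemma IsCategory.rotate_left_down {C : Set TCP} (hC : IsCategory C) {α : Type} {c : Color} {a : α}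
    {u l : List (Color × α)} (h : ofLists ((c, a) :: u) l ∈ C) :
    ofLists u ((!c, a) :: l) ∈ C := by
  have hq := hC.tensor_ofLists (hC.pair_mem (!c)) (hC.strands_mem u)
  have hp := hC.tensor_ofLists (hC.id_mem (!c)) h
  have e1 : Relation.EqvGen (glue (mapLabel Sum.inl [(!c, ()), (!!c, ())] ++
        mapLabel (Sum.inr : _ → Unit ⊕ _) (strands u))
      (mapLabel (Sum.inl : Unit → Unit ⊕ α) [(!c, ())] ++ mapLabel Sum.inr ((c, a) :: u)))
      (Sum.inr (Sum.inl ())) (Sum.inl (Sum.inl ())) :=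
    .symm _ _ (.rel _ _ ⟨((!c, Sum.inl ()), (!c, Sum.inl ())), by simp, rfl, rfl⟩)
  have e2 : Relation.EqvGen (glue (mapLabel Sum.inl [(!c, ()), (!!c, ())] ++
        mapLabel (Sum.inr : _ → Unit ⊕ _) (strands u))
      (mapLabel (Sum.inl : Unit → Unit ⊕ α) [(!c, ())] ++ mapLabel Sum.inr ((c, a) :: u)))
      (Sum.inl (Sum.inl ())) (Sum.inr (Sum.inr a)) :=
    .rel _ _ ⟨((!!c, Sum.inl ()), (c, Sum.inr a)), by simp, rfl, rfl⟩
  have := hC.comp_ofLists hq hp ?_ (Sum.elim (fun _ => a) fun t => t.1.2)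
    (Sum.elim (fun _ => a) id) (fun b => Sum.inr (Sum.inr b)) ?_ ?_ ?_
  · simp only [mapLabel_nil, List.nil_append, mapLabel_append, mapLabel_mapLabel, mapLabel_cons,
      Sum.elim_comp_inr] at this
    rw [mapLabel_eq_self (f := id) (fun _ _ => rfl)] at this
    have e : mapLabel (fun t : (Color × α) × ℕ => t.1.2) (strands u) = u := by
      exact (mapLabel_strands id u).trans (mapLabel_eq_self fun _ _ => rfl)
    rwa [e] at this
  · have := map_fst_strands u
    simp only [mapLabel, List.map_append, List.map_map, List.map_cons] at this ⊢
    simpa [Function.comp_def] using this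
  · intro t ht
    simp only [mapLabel_cons, mapLabel_nil, List.cons_append, List.nil_append, List.zip_cons_cons,
      zip_strands, List.mem_cons, List.mem_map] at ht
    rcases ht with rfl | rfl | ⟨s, hs, rfl⟩ <;> rfl
  · intro t ht
    simp only [mapLabel_nil, List.nil_append] at ht
    obtain ⟨s, hs, rfl⟩ := mem_mapLabel.1 ht
    obtain ⟨s, hs', rfl⟩ := List.mem_map.1 hs
    refine .rel _ _ ⟨((s.1.1, Sum.inr s), (s.1.1, Sum.inr s.1.2)), ?_, rfl, rfl⟩
    simp only [mapLabel_cons, mapLabel_nil, List.cons_append, List.nil_append, List.zip_cons_cons,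
      zip_strands, List.mem_cons, List.mem_map]
    exact Or.inr (Or.inr ⟨s, hs', rfl⟩)
  · intro t ht
    rcases t with ⟨c', ⟨⟩ | b⟩
    · exact e1.trans _ _ _ e2
    · exact .refl _

/-- Rotation of a single upper point to the right end of the lower row. -/
lemma IsCategory.rotate_right_down {C : Set TCP} (hC : IsCategory C) {α : Type} {c : Color}
    {a : α} {l : List (Color × α)} (h : ofLists [(c, a)] l ∈ C) :
    ofLists [] (l ++ [(!c, a)]) ∈ C := by
  have hp := hC.tensor_ofLists h (hC.id_mem (!c))
  have e1 : Relation.EqvGen (glue [(c, ()), (!c, ())]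
      (mapLabel (Sum.inl : α → α ⊕ Unit) [(c, a)] ++ mapLabel Sum.inr [(!c, ())]))
      (Sum.inr (Sum.inr ())) (Sum.inl ()) :=
    .symm _ _ (.rel _ _ ⟨((!c, ()), (!c, Sum.inr ())), by simp, rfl, rfl⟩)
  have e2 : Relation.EqvGen (glue [(c, ()), (!c, ())]
      (mapLabel (Sum.inl : α → α ⊕ Unit) [(c, a)] ++ mapLabel Sum.inr [(!c, ())]))
      (Sum.inl ()) (Sum.inr (Sum.inl a)) :=
    .rel _ _ ⟨((c, ()), (c, Sum.inl a)), by simp, rfl, rfl⟩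
  have := hC.comp_ofLists (hC.pair_mem c) hp rfl (fun _ => a)
    (Sum.elim id fun _ => a) (fun b => Sum.inr (Sum.inl b)) (by simp) (by simp) ?_
  · simp only [mapLabel_nil, mapLabel_append, mapLabel_mapLabel,
      mapLabel_cons, Sum.elim_comp_inl] at this
    rwa [mapLabel_eq_self (f := id) (fun _ _ => rfl)] at this
  · rintro ⟨c', b | ⟨⟩⟩ ht
    · exact .refl _
    · exact e1.trans _ _ _ e2

open Classical in
/-- Erasing the first two points, of opposite colors, joining their blocks. -/
lemma IsCategory.contract_head {C : Set TCP} (hC : IsCategory C) {α : Type} {c : Color} {a b : α}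
    {l : List (Color × α)} (h : ofLists [] ((c, a) :: (!c, b) :: l) ∈ C) :
    ofLists [] (mapLabel (fun k => if k = b then a else k) l) ∈ C := by
  have h2 := hC.invol_mem _ (hC.pair_mem c)
  rw [invol_ofLists] at h2
  have hp := hC.tensor_ofLists h2 (hC.strands_mem l)
  have e1 : Relation.EqvGen (glue ((c, a) :: (!c, b) :: l)
      (mapLabel Sum.inl [(c, ()), (!c, ())] ++ mapLabel (Sum.inr : _ → Unit ⊕ _) (strands l)))
      (Sum.inl b) (Sum.inr (Sum.inl ())) :=
    .rel _ _ ⟨((!c, b), (!c, Sum.inl ())), by simp, rfl, rfl⟩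
  have e2 : Relation.EqvGen (glue ((c, a) :: (!c, b) :: l)
      (mapLabel Sum.inl [(c, ()), (!c, ())] ++ mapLabel (Sum.inr : _ → Unit ⊕ _) (strands l)))
      (Sum.inr (Sum.inl ())) (Sum.inl a) :=
    .symm _ _ (.rel _ _ ⟨((c, a), (c, Sum.inl ())), by simp, rfl, rfl⟩)
  have hz : l.zip (mapLabel (Sum.inr : _ → Unit ⊕ _) (strands l)) =
      l.zipIdx.map fun t => ((t.1.1, t.1.2), (t.1.1, Sum.inr t)) := by
    have := congrArg (List.map Prod.swap) (zip_strands (Sum.inr : _ → Unit ⊕ _) id l)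
    rw [List.zip_swap, mapLabel_eq_self (f := id) (fun _ _ => rfl)] at this
    rw [this, List.map_map]
    rfl
  have := hC.comp_ofLists h hp ?_ (fun k => if k = b then a else k)
    (Sum.elim (fun _ => a) fun t => if t.1.2 = b then a else t.1.2) Sum.inl ?_ (by simp) ?_
  · simp only [mapLabel_nil, List.nil_append, mapLabel_mapLabel, Sum.elim_comp_inr] at this
    rwa [mapLabel_strands (fun k => if k = b then a else k)] at this
  · have := map_fst_strands l
    simp only [mapLabel, List.map_append, List.map_map, List.map_cons] at this ⊢
    simpa [Function.comp_def] using this.symm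
  · intro t ht
    simp only [mapLabel_cons, mapLabel_nil, List.cons_append, List.nil_append, List.zip_cons_cons,
      hz, List.mem_cons, List.mem_map] at ht
    rcases ht with rfl | rfl | ⟨s, hs, rfl⟩
    · simp
    · simp
    · rfl
  · intro t ht
    simp only [mapLabel_nil, List.nil_append] at ht
    obtain ⟨s, hs, rfl⟩ := mem_mapLabel.1 ht
    obtain ⟨s, hs', rfl⟩ := List.mem_map.1 hs
    have e3 : Relation.EqvGen (glue ((c, a) :: (!c, b) :: l)
        (mapLabel Sum.inl [(c, ()), (!c, ())] ++ mapLabel (Sum.inr : _ → Unit ⊕ _) (strands l)))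
        (Sum.inr (Sum.inr s)) (Sum.inl s.1.2) := by
      refine .symm _ _ (.rel _ _ ⟨((s.1.1, s.1.2), (s.1.1, Sum.inr s)), ?_, rfl, rfl⟩)
      simp only [mapLabel_cons, mapLabel_nil, List.cons_append, List.nil_append, List.zip_cons_cons,
        hz, List.mem_cons, List.mem_map]
      exact Or.inr (Or.inr ⟨s, hs', rfl⟩)
    by_cases hb : s.1.2 = b
    · simp only [Sum.elim_inr, hb, if_true] at e3 ⊢
      exact e3.trans _ _ _ (e1.trans _ _ _ e2)
    · simp only [Sum.elim_inr, hb, if_false]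
      exact e3

/-- Verticolor reflection of a row of colored labels. -/
def tilde {α : Type} (l : List (Color × α)) : List (Color × α) :=
  (l.map fun s => (!s.1, s.2)).reverse

lemma mem_tilde {α : Type} {l : List (Color × α)} {s : Color × α} :
    s ∈ tilde l ↔ (!s.1, s.2) ∈ l := by
  obtain ⟨c, a⟩ := s
  simp only [tilde, List.mem_reverse, List.mem_map, Prod.exists, Prod.mk.injEq]
  constructor
  · rintro ⟨c', a', h, rfl, rfl⟩
    simpa using h
  · intro h
    exact ⟨_, _, h, by simp, rfl⟩

lemma IsCategory.tilde_mem {C : Set TCP} (hC : IsCategory C) {α : Type} {l : List (Color × α)}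
    (h : ofLists [] l ∈ C) : ofLists [] (tilde l) ∈ C := by
  have key : ∀ u v : List (Color × α), ofLists u v ∈ C → ofLists [] (tilde u ++ v) ∈ C := by
    intro u
    induction u with
    | nil => intro v hv; exact hv
    | cons s u ih =>
      intro v hv
      have := ih _ (hC.rotate_left_down hv)
      simpa [tilde] using this
  have h' := hC.invol_mem _ h
  rw [invol_ofLists] at h'
  simpa using key _ _ h'

lemma IsCategory.rotate {C : Set TCP} (hC : IsCategory C) {α : Type} (u v : List (Color × α))
    (h : ofLists [] (u ++ v) ∈ C) : ofLists [] (v ++ u) ∈ C := by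
  induction u generalizing v with
  | nil => simpa using h
  | cons s u ih =>
    have h1 : ofLists [(!s.1, s.2)] (u ++ v) ∈ C := by
      have h2 := hC.invol_mem _ h
      rw [invol_ofLists] at h2
      have h3 := hC.invol_mem _ (hC.rotate_left_down h2)
      rwa [invol_ofLists] at h3
    have h4 := hC.rotate_right_down h1
    rw [Bool.not_not, List.append_assoc] at h4
    simpa using ih _ h4

open Classical in
/-- Erasing two adjacent points of opposite colors, joining their blocks. -/
lemma IsCategory.contract {C : Set TCP} (hC : IsCategory C) {α : Type} {c : Color} {a b : α}
    {u v : List (Color × α)} (h : ofLists [] (u ++ (c, a) :: (!c, b) :: v) ∈ C) :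
    ofLists [] (mapLabel (fun k => if k = b then a else k) (u ++ v)) ∈ C := by
  have h' := hC.rotate _ _ h
  rw [List.cons_append, List.cons_append] at h'
  have := hC.contract_head h'
  rw [mapLabel_append] at this ⊢
  exact hC.rotate _ _ this

/-! ### Nest decomposed forms in terms of lists -/

/-- The number of white points minus the number of black points of a row. -/
def colorSum {α : Type} (l : List (Color × α)) : ℤ :=
  (l.map fun s => if s.1 = white then (1 : ℤ) else -1).sum

@[simp] lemma colorSum_nil {α : Type} : colorSum ([] : List (Color × α)) = 0 := rfl

@[simp] lemma colorSum_cons {α : Type} (s : Color × α) (l : List (Color × α)) :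
    colorSum (s :: l) = (if s.1 = white then 1 else -1) + colorSum l := by simp [colorSum]

@[simp] lemma colorSum_append {α : Type} (l l' : List (Color × α)) :
    colorSum (l ++ l') = colorSum l + colorSum l' := by simp [colorSum]

@[simp] lemma colorSum_mapLabel {α β : Type} (f : α → β) (l : List (Color × α)) :
    colorSum (mapLabel f l) = colorSum l := by
  simp [colorSum, mapLabel, Function.comp_def]

lemma colorSum_tilde {α : Type} (l : List (Color × α)) : colorSum (tilde l) = -colorSum l := by
  induction l with
  | nil => rfl
  | cons s l ih =>
    have : tilde (s :: l) = tilde l ++ [(!s.1, s.2)] := by simp [tilde]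
    rw [this, colorSum_append, ih, colorSum_cons, colorSum_cons, colorSum_nil]
    cases s.1 <;> simp [white]

lemma colorSum_pair {α : Type} (c : Color) (a b : α) : colorSum [(c, a), (!c, b)] = 0 := by
  cases c <;> simp [white]

lemma cval_ofLists {α : Type} (l : List (Color × α)) : cval (ofLists [] l) = colorSum l := by
  have h1 : ∀ c, Nat.card {j : Fin (ofLists [] l).l // (ofLists [] l).lowColor j = c} =
      ∑ j : Fin l.length, if (l.get j).1 = c then 1 else 0 := by
    intro c
    rw [← Finset.card_filter, Nat.card_eq_fintype_card]
    exact Fintype.card_subtype _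
  have h0 : ∀ c, Nat.card {j : Fin (ofLists [] l).k // (ofLists [] l).upColor j = c} = 0 := by
    intro c
    have : IsEmpty {j : Fin (ofLists [] l).k // (ofLists [] l).upColor j = c} :=
      ⟨fun j => j.1.elim0⟩
    exact Nat.card_of_isEmpty
  rw [cval, h1, h1, h0, h0]
  have h2 : colorSum l = ∑ j : Fin l.length, if (l.get j).1 = white then (1 : ℤ) else -1 := by
    rw [colorSum, ← List.sum_ofFn]
    congr 1
    apply List.ext_getElem <;> simp
  rw [h2]
  push_cast
  rw [add_zero, add_zero, ← Finset.sum_sub_distrib]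
  refine Finset.sum_congr rfl fun j _ => ?_
  cases (l.get j).1 <;> simp [white, black]

lemma tensor_eq_append {α : Type} (u w : List (Color × α)) (h : ∀ s ∈ u, ∀ t ∈ w, s.2 ≠ t.2) :
    tensor (ofLists [] u) (ofLists [] w) = ofLists [] (u ++ w) := by
  rw [tensor_ofLists, ← ofLists_mapLabel (Sum.elim id id : α ⊕ α → α)]
  · simp only [mapLabel_nil, List.append_nil, mapLabel_append, mapLabel_mapLabel, Sum.elim_comp_inl,
      Sum.elim_comp_inr]
    rw [mapLabel_eq_self (fun _ _ => rfl), mapLabel_eq_self (fun _ _ => rfl)]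
  · simp only [mapLabel_nil, List.nil_append, List.mem_append]
    rintro s (hs | hs) t (ht | ht) hst <;> obtain ⟨s, hs', rfl⟩ := mem_mapLabel.1 hs <;>
      obtain ⟨t, ht', rfl⟩ := mem_mapLabel.1 ht
    · exact congrArg Sum.inl hst
    · exact absurd hst (h s hs' t ht')
    · exact absurd hst.symm (h t ht' s hs')
    · exact congrArg Sum.inr hst

lemma exists_of_mem_Kset {C : Set TCP} {x y : Color} {n : ℤ} (h : n ∈ Kset C x y) :
    ∃ (α : Type) (u v : List (Color × α)) (a : α),
      ofLists [] (u ++ (x, a) :: (v ++ [(y, a)])) ∈ C ∧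
      (∀ s ∈ u, s.2 ≠ a ∧ ∀ t ∈ v, s.2 ≠ t.2) ∧ colorSum u = n := by
  obtain ⟨p₁, p₂, ⟨hmem, -, hk₁, hk₂, -, hl, hx, hy, hr⟩, hn⟩ := h
  obtain ⟨α, u₁, l₁, rfl⟩ := exists_ofLists p₁
  obtain ⟨β, u₂, l₂, rfl⟩ := exists_ofLists p₂
  obtain rfl := List.length_eq_zero_iff.1 hk₁
  obtain rfl := List.length_eq_zero_iff.1 hk₂
  rcases l₂ with _ | ⟨⟨c, a⟩, l₂⟩
  · simp [ofLists] at hl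
  rcases List.eq_nil_or_concat' l₂ with rfl | ⟨v, ⟨d, b⟩, rfl⟩
  · simp [ofLists] at hl
  obtain rfl : c = x := hx
  have hlast : ((c, a) :: (v ++ [(d, b)])).get
      ⟨((c, a) :: (v ++ [(d, b)])).length - 1, by simp⟩ = (d, b) := by simp
  obtain rfl : d = y := (congrArg Prod.fst hlast).symm.trans hy
  obtain rfl : a = b := Eq.trans (b := (((c, a) :: (v ++ [(d, b)])).get
      ⟨((c, a) :: (v ++ [(d, b)])).length - 1, by simp⟩).2) hr (congrArg Prod.snd hlast)
  rw [tensor_ofLists] at hmem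
  refine ⟨α ⊕ β, mapLabel Sum.inl l₁, mapLabel Sum.inr v, Sum.inr a, ?_, ?_, ?_⟩
  · simpa using hmem
  · intro s hs
    obtain ⟨s, hs, rfl⟩ := mem_mapLabel.1 hs
    refine ⟨by simp, fun t ht => ?_⟩
    obtain ⟨t, ht, rfl⟩ := mem_mapLabel.1 ht
    simp
  · rw [colorSum_mapLabel, ← cval_ofLists, hn]

section Noncrossing

variable {C : Set TCP}

lemma mem_Kset_of_ne_nil (hNC : ∀ p ∈ C, Noncrossing p) {α : Type} {x y : Color}
    {u v : List (Color × α)} {a : α}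
    (h : ofLists [] (u ++ (x, a) :: (v ++ [(y, a)])) ∈ C) (hu : u ≠ [])
    (hd : ∀ s ∈ u, s.2 ≠ a ∧ ∀ t ∈ v, s.2 ≠ t.2) : colorSum u ∈ Kset C x y := by
  have ht : tensor (ofLists [] u) (ofLists [] ((x, a) :: (v ++ [(y, a)]))) =
      ofLists [] (u ++ (x, a) :: (v ++ [(y, a)])) := by
    refine tensor_eq_append _ _ fun s hs t ht => ?_
    simp only [List.mem_cons, List.mem_append, List.not_mem_nil, or_false] at ht
    rcases ht with rfl | ht | rfl
    · exact (hd s hs).1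
    · exact (hd s hs).2 t ht
    · exact (hd s hs).1
  have hlast : ((x, a) :: (v ++ [(y, a)])).get
      ⟨((x, a) :: (v ++ [(y, a)])).length - 1, by simp⟩ = (y, a) := by simp
  refine ⟨ofLists [] u, ofLists [] ((x, a) :: (v ++ [(y, a)])),
    ⟨by rwa [ht], by rw [ht]; exact hNC _ h, rfl, rfl, List.length_pos_of_ne_nil hu,
      by simp [ofLists], rfl, congrArg Prod.fst hlast, ?_⟩, cval_ofLists u⟩
  exact (congrArg Prod.snd hlast).symm

lemma mem_Kset (hC : IsCategory C) (hNC : ∀ p ∈ C, Noncrossing p) {α : Type} {x y : Color}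
    {u v : List (Color × α)} {a : α}
    (h : ofLists [] (u ++ (x, a) :: (v ++ [(y, a)])) ∈ C)
    (hd : ∀ s ∈ u, s.2 ≠ a ∧ ∀ t ∈ v, s.2 ≠ t.2) : colorSum u ∈ Kset C x y := by
  rcases eq_or_ne u [] with rfl | hu
  · have h' := hC.tensor_ofLists (hC.pair_mem white) h
    simp only [mapLabel_nil, List.nil_append, mapLabel_cons, mapLabel_append] at h'
    have := mem_Kset_of_ne_nil hNC h' (by simp) ?_
    · rwa [colorSum_pair] at this
    · intro s hs
      have hs' : s.2 = Sum.inl () := by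
        simp only [List.mem_cons, List.not_mem_nil, or_false] at hs
        rcases hs with rfl | rfl <;> rfl
      rw [hs']
      refine ⟨by simp, fun t ht => ?_⟩
      obtain ⟨t, ht, rfl⟩ := mem_mapLabel.1 ht
      simp
  · exact mem_Kset_of_ne_nil hNC h hu hd

lemma noncrossing_labels (hNC : ∀ p ∈ C, Noncrossing p) {α : Type} {l : List (Color × α)}
    (h : ofLists [] l ∈ C) {i j k m : ℕ} (hij : i < j) (hjk : j < k) (hkm : k < m)
    (hm : m < l.length) (hik : l[i].2 = l[k].2) (hjm : l[j].2 = l[m].2) : l[i].2 = l[j].2 :=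
  hNC _ h (Sum.inr ⟨i, by change i < l.length; omega⟩) (Sum.inr ⟨j, by change j < l.length; omega⟩)
    (Sum.inr ⟨k, by change k < l.length; omega⟩) (Sum.inr ⟨m, hm⟩)
    (Nat.add_lt_add_left hij _) (Nat.add_lt_add_left hjk _) (Nat.add_lt_add_left hkm _) hik hjm

/-- The gap between two consecutive points of a block gives an element of `K`. -/
lemma gap_mem_Kset (hC : IsCategory C) (hNC : ∀ p ∈ C, Noncrossing p) {α : Type} {c d : Color}
    {a : α} {u v : List (Color × α)} (h : ofLists [] ((c, a) :: (u ++ (d, a) :: v)) ∈ C)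
    (hu : ∀ s ∈ u, s.2 ≠ a) : colorSum u ∈ Kset C d c := by
  have h' := hC.rotate [(c, a)] (u ++ (d, a) :: v) h
  rw [List.append_assoc, List.cons_append] at h'
  refine mem_Kset hC hNC h' fun s hs => ⟨hu s hs, fun t ht hst => ?_⟩
  obtain ⟨i, hi, rfl⟩ := List.mem_iff_getElem.1 hs
  obtain ⟨j, hj, rfl⟩ := List.mem_iff_getElem.1 ht
  have := noncrossing_labels hNC h (i := 0) (j := i + 1) (k := u.length + 1)
    (m := u.length + 1 + j + 1) (by omega) (by omega) (by omega) (by simp; omega)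
    (by simp) (by
      simp only [List.getElem_cons_succ]
      rw [List.getElem_append_left hi, List.getElem_append_right (by omega)]
      simp only [show u.length + 1 + j - u.length = j + 1 by omega, List.getElem_cons_succ]
      exact hst)
  simp only [List.getElem_cons_zero, List.getElem_cons_succ] at this
  rw [List.getElem_append_left hi] at this
  exact hu _ hs this.symm

end Noncrossing

/-! ### Splicing partitions and the arithmetic of `K` -/

open Classical in
/-- Erasing the last point of one row together with the first point of another, of opposite
color, joining their blocks. -/
lemma IsCategory.splice {C : Set TCP} (hC : IsCategory C) {α β : Type} {c : Color} {a : α} {b : β}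
    {p : List (Color × α)} {q : List (Color × β)} (hp : ofLists [] (p ++ [(c, a)]) ∈ C)
    (hq : ofLists [] ((!c, b) :: q) ∈ C) :
    ofLists [] (mapLabel Sum.inl p ++
      mapLabel (fun k => if k = b then Sum.inl a else Sum.inr k : β → α ⊕ β) q) ∈ C := by
  have h := hC.tensor_ofLists hp hq
  simp only [mapLabel_nil, List.append_nil, mapLabel_cons, mapLabel_append, List.append_assoc,
    List.cons_append, List.nil_append] at h
  have h' := hC.contract h
  rw [mapLabel_append, mapLabel_mapLabel, mapLabel_mapLabel] at h'
  convert h' using 4 <;> funext k <;> simp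

lemma exists_first_label {α : Type} {a : α} {l : List (Color × α)} (h : ∃ s ∈ l, s.2 = a) :
    ∃ (p : List (Color × α)) (c : Color) (q : List (Color × α)),
      l = p ++ (c, a) :: q ∧ ∀ s ∈ p, s.2 ≠ a := by
  induction l with
  | nil => simp at h
  | cons s l ih =>
    by_cases hs : s.2 = a
    · exact ⟨[], s.1, l, by simp [← hs], by simp⟩
    · obtain ⟨p, c, q, rfl, hp⟩ := ih (by simpa [hs] using h)
      exact ⟨s :: p, c, q, rfl, by simpa [hs] using hp⟩

lemma exists_adjacent_or_monochromatic {α : Type} (l : List (Color × α)) :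
    (∃ (p q : List (Color × α)) (c : Color) (a b : α), l = p ++ (c, a) :: (!c, b) :: q) ∨
      ∃ c, ∀ s ∈ l, s.1 = c := by
  induction l with
  | nil => exact Or.inr ⟨white, by simp⟩
  | cons s l ih =>
    rcases ih with ⟨p, q, c, a, b, rfl⟩ | ⟨c, hc⟩
    · exact Or.inl ⟨s :: p, q, c, a, b, rfl⟩
    · rcases l with _ | ⟨t, l⟩
      · exact Or.inr ⟨s.1, by simp⟩
      · by_cases hst : t.1 = s.1
        · refine Or.inr ⟨c, fun r hr => ?_⟩
          rcases List.mem_cons.1 hr with rfl | hr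
          · rw [← hst]; exact hc t (by simp)
          · exact hc r hr
        · refine Or.inl ⟨[], l, s.1, s.2, t.2, ?_⟩
          rw [← Bool.eq_not.2 hst]
          rfl

section Arithmetic

variable {C : Set TCP} {x y z : Color} {m n : ℤ}

lemma neg_mem_Kset (hC : IsCategory C) (hNC : ∀ p ∈ C, Noncrossing p) (h : n ∈ Kset C x y) :
    -n ∈ Kset C (!y) (!x) := by
  obtain ⟨α, u, v, a, hmem, hd, rfl⟩ := exists_of_mem_Kset h
  have h' : ofLists [] (((!y, a) :: (tilde v ++ [(!x, a)])) ++ tilde u) ∈ C := by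
    simpa [tilde] using hC.tilde_mem hmem
  rw [← colorSum_tilde]
  refine mem_Kset hC hNC (hC.rotate _ _ h') fun s hs => ?_
  have := hd _ (mem_tilde.1 hs)
  exact ⟨this.1, fun t ht => this.2 (!t.1, t.2) (mem_tilde.1 ht)⟩

lemma add_mem_Kset (hC : IsCategory C) (hNC : ∀ p ∈ C, Noncrossing p) (hm : m ∈ Kset C x y)
    (hn : n ∈ Kset C (!y) z) : m + n ∈ Kset C x z := by
  classical
  obtain ⟨α, u, v, a, h₁, hd, rfl⟩ := exists_of_mem_Kset hm
  obtain ⟨β, u', v', b, h₂, hd', rfl⟩ := exists_of_mem_Kset hn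
  have h := hC.splice (p := u ++ (x, a) :: v) (by simpa using h₁) (hC.rotate u' _ h₂)
  set g : β → α ⊕ β := fun k => if k = b then Sum.inl a else Sum.inr k with hg
  have h' := hC.rotate (mapLabel Sum.inl (u ++ (x, a) :: v) ++ mapLabel g (v' ++ [(z, b)]))
    (mapLabel g u') (by simpa using h)
  have hb : g b = Sum.inl a := if_pos rfl
  have key := mem_Kset hC hNC (u := mapLabel g u' ++ mapLabel Sum.inl u) (x := x) (a := Sum.inl a)
    (v := mapLabel Sum.inl v ++ mapLabel g v') (y := z) (by simpa [hb] using h') ?_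
  · simpa [add_comm] using key
  · simp only [List.mem_append]
    rintro s (hs | hs) <;> obtain ⟨s, hs', rfl⟩ := mem_mapLabel.1 hs
    · obtain ⟨hsb, hsv⟩ := hd' s hs'
      simp only [hg, hsb, if_false]
      refine ⟨by simp, ?_⟩
      rintro t (ht | ht) <;> obtain ⟨t, ht', rfl⟩ := mem_mapLabel.1 ht
      · simp
      · by_cases htb : t.2 = b
        · simp [htb]
        · simpa [htb] using hsv t ht'
    · obtain ⟨hsa, hsv⟩ := hd s hs'
      refine ⟨by simpa using hsa, ?_⟩
      rintro t (ht | ht) <;> obtain ⟨t, ht', rfl⟩ := mem_mapLabel.1 ht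
      · simpa using hsv t ht'
      · by_cases htb : t.2 = b
        · simpa [hg, htb] using hsa
        · simp [hg, htb]

lemma colorSum_mem_Kset (hC : IsCategory C) (hNC : ∀ p ∈ C, Noncrossing p) {α : Type}
    {l : List (Color × α)} (h : ofLists [] l ∈ C) (x : Color) : colorSum l ∈ Kset C x (!x) := by
  have h' := hC.tensor_ofLists h (hC.pair_mem x)
  have := mem_Kset hC hNC (u := mapLabel Sum.inl l) (x := x) (v := []) (a := Sum.inr ()) (y := !x)
    (by simpa using h') ?_
  · simpa using this
  · intro s hs
    obtain ⟨s, -, rfl⟩ := mem_mapLabel.1 hs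
    simp

lemma zero_mem_Kset (hC : IsCategory C) (hNC : ∀ p ∈ C, Noncrossing p) (x : Color) :
    0 ∈ Kset C x (!x) := by
  simpa only [colorSum_pair] using colorSum_mem_Kset hC hNC (hC.pair_mem x) x

/-- If there are neither singleton blocks nor elements in `K(c, c)`, then all tensor factors are
color balanced. -/
lemma colorSum_eq_zero (hC : IsCategory C) (hNC : ∀ p ∈ C, Noncrossing p)
    (hK : ∀ c n, n ∉ Kset C c c)
    (hsing : ∀ (α : Type) (c : Color) (a : α) (l : List (Color × α)),
      ofLists [] ((c, a) :: l) ∈ C → ∃ s ∈ l, s.2 = a)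
    {α : Type} (u w : List (Color × α)) (h : ofLists [] (u ++ w) ∈ C)
    (hd : ∀ s ∈ u, ∀ t ∈ w, s.2 ≠ t.2) : colorSum u = 0 := by
  classical
  induction hlen : u.length using Nat.strong_induction_on generalizing u w with
  | _ N ih =>
  rcases exists_adjacent_or_monochromatic u with ⟨p, q, c, a, b, rfl⟩ | ⟨c, hc⟩
  · have h' := hC.contract (u := p) (v := q ++ w) (by simpa using h)
    rw [← List.append_assoc, mapLabel_append] at h'
    have := ih (p ++ q).length (by simp at hlen ⊢; omega) _ _ h' ?_ (by simp [mapLabel])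
    · have hcol := colorSum_pair c a b
      simp at this hcol ⊢
      linarith
    · intro s hs t ht
      obtain ⟨s, hs', rfl⟩ := mem_mapLabel.1 hs
      obtain ⟨t, ht', rfl⟩ := mem_mapLabel.1 ht
      have hs'' : s ∈ p ++ (c, a) :: (!c, b) :: q := by
        simp only [List.mem_append, List.mem_cons] at hs' ⊢
        tauto
      have htb : t.2 ≠ b := (hd (!c, b) (by simp) t ht').symm
      by_cases hsb : s.2 = b
      · simpa [hsb, htb] using hd (c, a) (by simp) t ht'
      · simpa [hsb, htb] using hd s hs'' t ht'
  · rcases u with _ | ⟨⟨c', a⟩, u⟩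
    · rfl
    obtain rfl : c' = c := hc (c', a) (by simp)
    obtain ⟨s, hs, hsa⟩ := hsing α c' a (u ++ w) h
    have hsu : s ∈ u := (List.mem_append.1 hs).resolve_right fun hw =>
      hd (c', a) (by simp) s hw hsa.symm
    obtain ⟨p, d, q, rfl, hp⟩ := exists_first_label ⟨s, hsu, hsa⟩
    obtain rfl : d = c' := hc (d, a) (by simp)
    exact absurd (gap_mem_Kset hC hNC (v := q ++ w) (by simpa using h) hp) (hK _ _)

/-- A singleton block produces singleton blocks of both colors. -/
lemma IsCategory.exists_singleton (hC : IsCategory C) {α : Type} {c : Color} {a : α}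
    {l : List (Color × α)} (h : ofLists [] ((c, a) :: l) ∈ C) (hl : ∀ s ∈ l, s.2 ≠ a) (x : Color) :
    ∃ l' : List (Color × α), ofLists [] (l' ++ [(x, a)]) ∈ C ∧ ∀ s ∈ l', s.2 ≠ a := by
  by_cases hx : x = c
  · exact ⟨l, hx ▸ hC.rotate [(c, a)] l h, hl⟩
  · refine ⟨tilde l, ?_, fun s hs => hl (!s.1, s.2) (mem_tilde.1 hs)⟩
    rw [Bool.eq_not.2 hx]
    simpa [tilde] using hC.tilde_mem h

/-- A block with consecutive points of colors `!x`, `x`, `x` and a singleton block yield a block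
with consecutive points of color `x`. -/
lemma exists_mem_Kset_of_singleton (hC : IsCategory C) (hNC : ∀ p ∈ C, Noncrossing p)
    {α β : Type} {a : α} {b : β} {l : List (Color × α)} {p q u : List (Color × β)}
    (h : ofLists [] (l ++ [(x, a)]) ∈ C) (hl : ∀ s ∈ l, s.2 ≠ a)
    (h' : ofLists [] ((!x, b) :: (p ++ (x, b) :: (q ++ (x, b) :: u))) ∈ C)
    (hp : ∀ s ∈ p, s.2 ≠ b) (hu : ∀ s ∈ u, s.2 ≠ b) : ∃ n, n ∈ Kset C x x := by
  classical
  have key := hC.splice h h'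
  set g : β → α ⊕ β := fun k => if k = b then Sum.inl a else Sum.inr k with hg
  have hb : g b = Sum.inl a := if_pos rfl
  have hgu : ∀ s : Color × β, s.2 ≠ b → g s.2 ≠ Sum.inl a := fun s hs => by simp [hg, hs]
  have rot := hC.rotate
    (mapLabel Sum.inl l ++ mapLabel g (p ++ (x, b) :: q)) (mapLabel g ((x, b) :: u))
    (by simpa using key)
  refine ⟨_, gap_mem_Kset hC hNC (c := x) (d := x) (a := Sum.inl a)
    (u := mapLabel g u ++ (mapLabel Sum.inl l ++ mapLabel g p)) (v := mapLabel g q)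
    (by simpa [hb] using rot) ?_⟩
  simp only [List.mem_append]
  rintro s (hs | hs | hs) <;> obtain ⟨s, hs', rfl⟩ := mem_mapLabel.1 hs
  · exact hgu s (hu s hs')
  · simpa using hl s hs'
  · exact hgu s (hp s hs')

lemma mem_Kset_not_swap (hC : IsCategory C) (hNC : ∀ p ∈ C, Noncrossing p)
    (h : n ∈ Kset C (!x) x) : n ∈ Kset C x (!x) := by
  by_cases hK : ∃ c k, k ∈ Kset C c c
  · obtain ⟨k, hk⟩ : ∃ k, k ∈ Kset C x x := by
      obtain ⟨c, k, hk⟩ := hK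
      by_cases hx : x = c
      · exact ⟨k, hx ▸ hk⟩
      · exact ⟨-k, by rw [Bool.eq_not.2 hx]; exact neg_mem_Kset hC hNC hk⟩
    have := add_mem_Kset hC hNC (add_mem_Kset hC hNC hk h) (neg_mem_Kset hC hNC hk)
    simpa using this
  · push Not at hK
    obtain ⟨α, u, r, a, hmem, hd, rfl⟩ := exists_of_mem_Kset h
    have hrot := hC.rotate u _ hmem
    by_cases hr : ∃ s ∈ r, s.2 = a
    · obtain ⟨p, c, q, rfl, hp⟩ := exists_first_label hr
      by_cases hc : c = !x
      · exact absurd (gap_mem_Kset hC hNC (c := !x) (d := !x) (u := p) (v := q ++ (x, a) :: u)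
          (by simpa [hc] using hrot) hp) (hK _ _)
      obtain rfl : c = x := by simpa using Bool.eq_not.2 hc
      have hsing : ∀ (β : Type) (d : Color) (b : β) (l : List (Color × β)),
          ofLists [] ((d, b) :: l) ∈ C → ∃ s ∈ l, s.2 = b := by
        intro β d b l hl
        by_contra! hlb
        obtain ⟨l', hl', hlb'⟩ := hC.exists_singleton hl hlb c
        obtain ⟨k, hk⟩ := exists_mem_Kset_of_singleton hC hNC (b := a) (p := p) (q := q) (u := u)
          hl' hlb' (by simpa using hrot) hp fun s hs => (hd s hs).1
        exact hK _ _ hk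
      rw [colorSum_eq_zero hC hNC hK hsing u _ hmem]
      · exact zero_mem_Kset hC hNC c
      · intro s hs t ht
        simp only [List.mem_cons, List.mem_append (s := p ++ (c, a) :: q), List.not_mem_nil,
          or_false] at ht
        rcases ht with rfl | ht | rfl
        · exact (hd s hs).1
        · exact (hd s hs).2 t ht
        · exact (hd s hs).1
    · push Not at hr
      have hgap := gap_mem_Kset hC hNC (c := !x) (d := x) (u := r) (v := u)
        (by simpa using hrot) hr
      have htotal := colorSum_mem_Kset hC hNC hmem x
      have hneg := neg_mem_Kset hC hNC hgap
      have := add_mem_Kset hC hNC htotal (y := !x) (by simpa using hneg)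
      have hcol := colorSum_pair x a a
      simp at this hcol
      convert this using 1
      linarith

end Arithmetic

lemma eq_setOf_sInf_dvd (G : AddSubgroup ℤ) :
    (G : Set ℤ) = {n : ℤ | ((sInf {k : ℕ | 0 < k ∧ (k : ℤ) ∈ G} : ℕ) : ℤ) ∣ n} := by
  set d := sInf {k : ℕ | 0 < k ∧ (k : ℤ) ∈ G} with hd
  have hdG : (d : ℤ) ∈ G := by
    rcases Set.eq_empty_or_nonempty {k : ℕ | 0 < k ∧ (k : ℤ) ∈ G} with he | hne
    · simp [hd, he]
    · exact (Nat.sInf_mem hne).2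
  ext n
  refine ⟨fun hn => ?_, fun ⟨k, hk⟩ => ?_⟩
  · have key : ∀ k : ℕ, (k : ℤ) ∈ G → d ∣ k := by
      intro k hk
      by_contra hdk
      have hpos : 0 < k % d := Nat.pos_of_ne_zero fun h => hdk (Nat.dvd_of_mod_eq_zero h)
      have hmod : ((k % d : ℕ) : ℤ) ∈ G := by
        rw [Int.natCast_mod, Int.emod_def, mul_comm, ← smul_eq_mul]
        exact G.sub_mem hk (G.zsmul_mem hdG _)
      have hle : d ≤ k % d := Nat.sInf_le ⟨hpos, hmod⟩
      have hdpos : 0 < d :=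
        (Nat.sInf_mem (s := {k : ℕ | 0 < k ∧ (k : ℤ) ∈ G}) ⟨_, hpos, hmod⟩).1
      exact absurd (Nat.mod_lt k hdpos) (not_lt.2 hle)
    refine Int.natCast_dvd.2 (key _ ?_)
    rcases Int.natAbs_eq n with h | h
    · rwa [← h]
    · rw [← neg_eq_iff_eq_neg.2 h]
      exact G.neg_mem hn
  · rw [hk, mul_comm, ← smul_eq_mul]
    exact G.zsmul_mem hdG k

/-- `K^C(∘,•) = K^C(•,∘) = d(C)·ℤ` and `K^C(∘,∘) = −K^C(•,•)`. -/
theorem stmt_7 (C : Set TCP) (hC : IsCategory C) (hNC : ∀ p ∈ C, Noncrossing p) :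
    Kset C white black = {n : ℤ | (ddeg C : ℤ) ∣ n} ∧
    Kset C black white = {n : ℤ | (ddeg C : ℤ) ∣ n} ∧
    Kset C white white = (fun n : ℤ => -n) '' Kset C black black := by
  have hswap : Kset C black white = Kset C white black :=
    Set.Subset.antisymm (fun _ h => mem_Kset_not_swap (x := white) hC hNC h)
      (fun _ h => mem_Kset_not_swap (x := black) hC hNC h)
  let G : AddSubgroup ℤ :=
    { carrier := Kset C white black
      zero_mem' := zero_mem_Kset hC hNC white
      add_mem' := fun {m n} hm hn => add_mem_Kset hC hNC (y := black) hm hn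
      neg_mem' := fun {n} hn => neg_mem_Kset hC hNC hn }
  have hG : Kset C white black = {n : ℤ | (ddeg C : ℤ) ∣ n} := eq_setOf_sInf_dvd G
  refine ⟨hG, hswap.trans hG, Set.Subset.antisymm (fun n hn => ?_) ?_⟩
  · exact ⟨-n, neg_mem_Kset hC hNC hn, neg_neg n⟩
  · rintro _ ⟨n, hn, rfl⟩
    exact neg_mem_Kset hC hNC hn

end CTCP
end
end

section
/- Let C ⊆ NC°• be a globally colorized category of noncrossing two-colored partitions. Then d(C) ∈ {1,2}, and d(C) = 1 if and only if p₁ ∈ C. Moreover K^C(∘,•) = K^C(•,∘) = K^C(∘,∘) = K^C(•,•) = d(C)ℤ. -/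
noncomputable section
namespace CTCP

open Relation

/-- The predicate on the points of a partition given by a predicate on the upper positions
and a predicate on the lower positions. -/
def label {k l : ℕ} (f g : ℕ → Prop) : Fin k ⊕ Fin l → Prop :=
  Sum.elim (fun i => f i) (fun j => g j)

/-- The predicates `f` on the upper and `g` on the lower positions are constant on the blocks
of `p`. -/
def Inv (p : TCP) (f g : ℕ → Prop) : Prop :=
  ∀ a b, p.rel.r a b → label f g a = label f g b

/-- `p` is an element of `C` with upper colors `U` and lower colors `L`. -/
structure Hom (C : Set TCP) (U L : List Color) (p : TCP) : Prop where
  mem : p ∈ C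
  up : List.ofFn p.upColor = U
  low : List.ofFn p.lowColor = L

section Basic

variable {C : Set TCP} {U L M U' L' : List Color} {p q t : TCP}

theorem Hom.k_eq (h : Hom C U L p) : p.k = U.length := by simp [← h.up]

theorem Hom.l_eq (h : Hom C U L p) : p.l = L.length := by simp [← h.low]

/-- The block relation is determined by the predicates constant on blocks. -/
theorem rel_iff_Inv (a b : Fin p.k ⊕ Fin p.l) :
    p.rel.r a b ↔ ∀ f g, Inv p f g → label f g a = label f g b := by
  refine ⟨fun h f g hfg => hfg a b h, fun H => ?_⟩
  have key := H (fun i => ∃ h, p.rel.r a (.inl ⟨i, h⟩)) (fun i => ∃ h, p.rel.r a (.inr ⟨i, h⟩)) ?_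
  · have base : p.rel.r a a := p.rel.iseqv.refl a
    rcases a with a | a <;> rcases b with b | b <;>
      exact ((iff_of_eq key).1 ⟨a.2, base⟩).2
  · intro x y hxy
    have : p.rel.r a x ↔ p.rel.r a y :=
      ⟨fun h => p.rel.iseqv.trans h hxy, fun h => p.rel.iseqv.trans h (p.rel.iseqv.symm hxy)⟩
    rcases x with x | x <;> rcases y with y | y <;> simpa [label] using this

/-- Partitions with the same colors and the same predicates constant on blocks are equal. -/
theorem eq_of_Inv (hu : List.ofFn p.upColor = List.ofFn q.upColor)
    (hl : List.ofFn p.lowColor = List.ofFn q.lowColor)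
    (h : ∀ f g, Inv p f g ↔ Inv q f g) : p = q := by
  have hk : p.k = q.k := by simpa using congrArg List.length hu
  have hl' : p.l = q.l := by simpa using congrArg List.length hl
  obtain ⟨k, l, uc, lc, r⟩ := p
  obtain ⟨k', l', uc', lc', r'⟩ := q
  dsimp only at hk hl'
  subst hk hl'
  have e1 : uc = uc' := List.ofFn_injective hu
  have e2 : lc = lc' := List.ofFn_injective hl
  subst e1 e2
  have e3 : r = r' := by
    refine Setoid.ext fun a b => ?_
    have h1 := rel_iff_Inv (p := ⟨k, l, uc, lc, r⟩) a b
    have h2 := rel_iff_Inv (p := ⟨k, l, uc, lc, r'⟩) a b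
    simp only [h] at h1
    exact h1.trans h2.symm
  rw [e3]

@[simp] theorem idPart_k (c : Color) : (idPart c).k = 1 := rfl
@[simp] theorem idPart_l (c : Color) : (idPart c).l = 1 := rfl
@[simp] theorem pairLower_k (c d : Color) : (pairLower c d).k = 0 := rfl
@[simp] theorem pairLower_l (c d : Color) : (pairLower c d).l = 2 := rfl
@[simp] theorem invol_k (p : TCP) : (invol p).k = p.l := rfl
@[simp] theorem invol_l (p : TCP) : (invol p).l = p.k := rfl
@[simp] theorem tensor_k (p q : TCP) : (tensor p q).k = p.k + q.k := rfl
@[simp] theorem tensor_l (p q : TCP) : (tensor p q).l = p.l + q.l := rfl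

theorem Inv_of_forall {c : Prop} {f g : ℕ → Prop} (hf : ∀ i < p.k, f i = c)
    (hg : ∀ j < p.l, g j = c) : Inv p f g := by
  have : ∀ a : Fin p.k ⊕ Fin p.l, label f g a = c := by
    rintro (a | a)
    · exact hf _ a.2
    · exact hg _ a.2
  intro a b _
  rw [this a, this b]

theorem Inv_tensor (f g : ℕ → Prop) : Inv (tensor p q) f g ↔
    Inv p f g ∧ Inv q (fun i => f (p.k + i)) (fun j => g (p.l + j)) := by
  let e₁ : Fin p.k ⊕ Fin p.l → Fin (p.k + q.k) ⊕ Fin (p.l + q.l) :=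
    Sum.map (Fin.castAdd _) (Fin.castAdd _)
  let e₂ : Fin q.k ⊕ Fin q.l → Fin (p.k + q.k) ⊕ Fin (p.l + q.l) :=
    Sum.map (Fin.natAdd _) (Fin.natAdd _)
  have s₁ : ∀ a, splitPt p q (e₁ a) = .inl a := by
    rintro (a | a) <;> simp [e₁, splitPt]
  have s₂ : ∀ a, splitPt p q (e₂ a) = .inr a := by
    rintro (a | a) <;> simp [e₂, splitPt]
  have v₁ : ∀ a, label f g (e₁ a) = label f g a := by
    rintro (a | a) <;> simp [e₁, label]
  have v₂ : ∀ a, label f g (e₂ a) =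
      label (fun i => f (p.k + i)) (fun j => g (p.l + j)) a := by
    rintro (a | a) <;> simp [e₂, label]
  have cov : ∀ z, (∃ a, z = e₁ a) ∨ ∃ a, z = e₂ a := by
    rintro (z | z)
    · exact Fin.addCases (fun i => .inl ⟨.inl i, rfl⟩) (fun i => .inr ⟨.inl i, rfl⟩) z
    · exact Fin.addCases (fun i => .inl ⟨.inr i, rfl⟩) (fun i => .inr ⟨.inr i, rfl⟩) z
  have r_def : ∀ a b, (tensor p q).rel.r a b ↔
      sumRel p.rel q.rel (splitPt p q a) (splitPt p q b) := fun a b => Iff.rfl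
  constructor
  · intro h
    refine ⟨fun a b hab => ?_, fun a b hab => ?_⟩
    · rw [← v₁, ← v₁]
      exact h _ _ ((r_def _ _).2 (by rw [s₁, s₁]; exact hab))
    · rw [← v₂, ← v₂]
      exact h _ _ ((r_def _ _).2 (by rw [s₂, s₂]; exact hab))
  · rintro ⟨h₁, h₂⟩ a b hab
    rw [r_def] at hab
    rcases cov a with ⟨a, rfl⟩ | ⟨a, rfl⟩ <;> rcases cov b with ⟨b, rfl⟩ | ⟨b, rfl⟩
    · rw [s₁, s₁] at hab
      exact (v₁ a).trans ((h₁ a b hab).trans (v₁ b).symm)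
    · rw [s₁, s₂] at hab; exact hab.elim
    · rw [s₁, s₂] at hab; exact hab.elim
    · rw [s₂, s₂] at hab
      exact (v₂ a).trans ((h₂ a b hab).trans (v₂ b).symm)

theorem Inv_invol (f g : ℕ → Prop) : Inv (invol p) f g ↔ Inv p g f := by
  have e : ∀ {k l : ℕ} (f g : ℕ → Prop) (a : Fin k ⊕ Fin l),
      label f g a.swap = label g f a := by
    rintro k l f g (a | a) <;> rfl
  constructor
  · intro h a b hab
    rw [← e f g a, ← e f g b]
    refine h a.swap b.swap ?_
    change p.rel.r a.swap.swap b.swap.swap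
    rwa [Sum.swap_swap, Sum.swap_swap]
  · intro h a b hab
    exact (e g f a).symm.trans ((h a.swap b.swap hab).trans (e g f b))

theorem Inv_idPart (c : Color) (f g : ℕ → Prop) : Inv (idPart c) f g ↔ f 0 = g 0 := by
  refine ⟨fun h => h (.inl (0 : Fin 1)) (.inr (0 : Fin 1)) trivial, fun h => ?_⟩
  rintro (⟨a, ha⟩ | ⟨a, ha⟩) (⟨b, hb⟩ | ⟨b, hb⟩) - <;> obtain rfl := Nat.lt_one_iff.1 ha <;>
    obtain rfl := Nat.lt_one_iff.1 hb <;> simp [label, h]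

theorem Inv_pairLower (c d : Color) (f g : ℕ → Prop) :
    Inv (pairLower c d) f g ↔ g 0 = g 1 := by
  refine ⟨fun h => h (.inr (0 : Fin 2)) (.inr (1 : Fin 2)) rfl, fun h => ?_⟩
  refine Inv_of_forall (c := g 0) (fun i hi => absurd hi (Nat.not_lt_zero i)) fun j hj => ?_
  have : j < 2 := hj
  interval_cases j
  · rfl
  · exact h.symm

theorem ofFn_sumElim {m n : ℕ} (f : Fin m → Color) (g : Fin n → Color) :
    List.ofFn (fun i : Fin (m + n) => (finSumFinEquiv.symm i).elim f g) =
      List.ofFn f ++ List.ofFn g := by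
  rw [← List.ofFn_fin_append]
  congr 1
  funext i
  refine Fin.addCases (fun i => ?_) (fun i => ?_) i <;> simp

theorem Hom.tensor (hC : IsCategory C) (hp : Hom C U L p) (hq : Hom C U' L' q) :
    Hom C (U ++ U') (L ++ L') (tensor p q) := by
  refine ⟨hC.tensor_mem _ hp.mem _ hq.mem, ?_, ?_⟩
  · rw [← hp.up, ← hq.up]; exact ofFn_sumElim _ _
  · rw [← hp.low, ← hq.low]; exact ofFn_sumElim _ _

theorem Hom.invol (hC : IsCategory C) (hp : Hom C U L p) : Hom C L U (invol p) :=
  ⟨hC.invol_mem _ hp.mem, hp.low, hp.up⟩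

theorem hom_idPart (hC : IsCategory C) (c : Color) : Hom C [c] [c] (idPart c) := by
  refine ⟨?_, by simp [idPart], by simp [idPart]⟩
  cases c
  · exact hC.idb_mem
  · exact hC.idw_mem

theorem hom_pairLower (hC : IsCategory C) (c : Color) :
    Hom C [] [c, !c] (pairLower c (!c)) := by
  refine ⟨?_, by simp [pairLower, mkLower], by simp [pairLower, mkLower]⟩
  cases c
  · exact hC.pairbw_mem
  · exact hC.pairwb_mem

/-- Composition in terms of predicates constant on blocks: it is the composition of the
corresponding relations between predicates. -/
theorem Hom.exists_comp (hC : IsCategory C) (hq : Hom C U M q) (hp : Hom C M L p) :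
    ∃ t, Hom C U L t ∧ ∀ f g, Inv t f g ↔ ∃ m, Inv q f m ∧ Inv p m g := by
  have h : q.l = p.k := by rw [hq.l_eq, hp.k_eq]
  have hm : ColorsMatch q p h := by
    intro j
    have e := hq.low.trans hp.up.symm
    have h1 : (List.ofFn q.lowColor)[j.1]'(by simp) = q.lowColor j := by simp
    rw [← h1]
    simp only [e]
    simp
    rfl
  have in_q : ∀ x y, q.rel.r x y → EqvGen (compRel q p h) (.inl x) (.inl y) :=
    fun x y hxy => .rel _ _ (.inl ⟨x, y, hxy, rfl, rfl⟩)
  have in_p : ∀ x y, p.rel.r x y →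
      EqvGen (compRel q p h) (compEmbMid q p h x) (compEmbMid q p h y) :=
    fun x y hxy => .rel _ _ (.inr ⟨x, y, hxy, rfl, rfl⟩)
  refine ⟨comp q p h, ⟨hC.comp_mem _ hq.mem _ hp.mem h hm, hq.up, hp.low⟩, fun f g => ⟨?_, ?_⟩⟩
  · intro H
    let out : Fin q.k ⊕ Fin p.l → (Fin q.k ⊕ Fin q.l) ⊕ Fin p.l :=
      Sum.elim (fun i => .inl (.inl i)) (fun j => .inr j)
    let S := fun z => ∃ a, EqvGen (compRel q p h) (out a) z ∧ label f g a
    have S_iff : ∀ z z', EqvGen (compRel q p h) z z' → (S z ↔ S z') := fun z z' hz =>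
      ⟨fun ⟨a, ha, hl⟩ => ⟨a, .trans _ _ _ ha hz, hl⟩,
        fun ⟨a, ha, hl⟩ => ⟨a, .trans _ _ _ ha (.symm _ _ hz), hl⟩⟩
    have S_out : ∀ a, S (out a) ↔ label f g a := fun a =>
      ⟨fun ⟨b, hb, hl⟩ => (iff_of_eq (H b a hb)).1 hl, fun hl => ⟨a, .refl _, hl⟩⟩
    have hlt : ∀ i : Fin p.k, i.1 < q.l := fun i => by rw [h]; exact i.2
    refine ⟨fun i => ∃ hi, S (.inl (.inr ⟨i, hi⟩)), fun x y hxy => ?_, fun x y hxy => ?_⟩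
    · have e : ∀ z : Fin q.k ⊕ Fin q.l,
          label f (fun i => ∃ hi, S (.inl (.inr ⟨i, hi⟩))) z ↔ S (.inl z) := by
        rintro (z | z)
        · exact (S_out (.inl z)).symm
        · simp [label]
      exact propext ((e x).trans ((S_iff _ _ (in_q _ _ hxy)).trans (e y).symm))
    · have e : ∀ z : Fin p.k ⊕ Fin p.l,
          label (fun i => ∃ hi, S (.inl (.inr ⟨i, hi⟩))) g z ↔ S (compEmbMid q p h z) := by
        rintro (z | z)
        · exact ⟨fun ⟨_, hz⟩ => hz, fun hz => ⟨hlt z, hz⟩⟩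
        · exact (S_out (.inr z)).symm
      exact propext ((e x).trans ((S_iff _ _ (in_p _ _ hxy)).trans (e y).symm))
  · rintro ⟨m, h1, h2⟩
    let F : (Fin q.k ⊕ Fin q.l) ⊕ Fin p.l → Prop :=
      Sum.elim (Sum.elim (fun i => f i) (fun i => m i)) (fun i => g i)
    have F_mid : ∀ x, F (compEmbMid q p h x) = label m g x := by
      rintro (x | x) <;> rfl
    have key : ∀ a b, EqvGen (compRel q p h) a b → F a = F b := by
      intro a b hab
      induction hab with
      | rel a b hab =>
        rcases hab with ⟨x, y, hxy, rfl, rfl⟩ | ⟨x, y, hxy, rfl, rfl⟩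
        · exact h1 _ _ hxy
        · rw [F_mid, F_mid]
          exact h2 _ _ hxy
      | refl a => rfl
      | symm a b _ ih => exact ih.symm
      | trans a b c _ _ ih ih' => exact ih.trans ih'
    intro a b hab
    have := key _ _ hab
    rcases a with a | a <;> rcases b with b | b <;> exact this

end Basic

section Recolor

variable {C : Set TCP} {γ γ' δ δ' ε : List Color}

/-- `C` contains the partition with upper colors `γ` and lower colors `γ'` whose blocks are the
vertical lines. -/
def Recol (C : Set TCP) (γ γ' : List Color) : Prop :=
  γ.length = γ'.length ∧
    ∃ p, Hom C γ γ' p ∧ ∀ f g, Inv p f g ↔ ∀ i < γ.length, f i = g i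

theorem Recol.nil (hC : IsCategory C) : Recol C [] [] := by
  obtain ⟨t, ht, -⟩ := (hom_pairLower hC true).exists_comp hC ((hom_pairLower hC true).invol hC)
  refine ⟨rfl, t, ht, fun f g => ⟨fun _ i hi => absurd hi (Nat.not_lt_zero i), fun _ => ?_⟩⟩
  refine Inv_of_forall (c := True) (fun i hi => ?_) (fun i hi => ?_)
  · simp [ht.k_eq] at hi
  · simp [ht.l_eq] at hi

theorem Recol.single (hC : IsCategory C) (c : Color) : Recol C [c] [c] := by
  refine ⟨rfl, _, hom_idPart hC c, fun f g => ?_⟩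
  simp [Inv_idPart]

theorem Recol.trans (hC : IsCategory C) (h : Recol C γ δ) (h' : Recol C δ ε) :
    Recol C γ ε := by
  obtain ⟨hl, p, hp, ip⟩ := h
  obtain ⟨hl', q, hq, iq⟩ := h'
  obtain ⟨t, ht, it⟩ := hp.exists_comp hC hq
  refine ⟨hl.trans hl', t, ht, fun f g => ?_⟩
  rw [it]
  constructor
  · rintro ⟨m, h1, h2⟩ i hi
    rw [(ip _ _).1 h1 i hi, (iq _ _).1 h2 i (hl ▸ hi)]
  · intro H
    exact ⟨f, (ip _ _).2 fun i _ => rfl, (iq _ _).2 fun i hi => H i (hl ▸ hi)⟩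

theorem Recol.append (hC : IsCategory C) (h : Recol C γ γ') (h' : Recol C δ δ') :
    Recol C (γ ++ δ) (γ' ++ δ') := by
  obtain ⟨hl, p, hp, ip⟩ := h
  obtain ⟨hl', q, hq, iq⟩ := h'
  refine ⟨by simp [hl, hl'], _, hp.tensor hC hq, fun f g => ?_⟩
  rw [Inv_tensor, ip, iq, hp.k_eq, hp.l_eq, ← hl]
  constructor
  · rintro ⟨h1, h2⟩ i hi
    by_cases hi' : i < γ.length
    · exact h1 i hi'
    · have := h2 (i - γ.length) (by simp at hi; omega)
      rwa [Nat.add_sub_cancel' (by omega)] at this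
  · intro H
    exact ⟨fun i hi => H i (by simp; omega), fun i hi => H _ (by simp; omega)⟩

theorem Recol.symm (hC : IsCategory C) (h : Recol C γ δ) : Recol C δ γ := by
  obtain ⟨hl, p, hp, ip⟩ := h
  refine ⟨hl.symm, _, hp.invol hC, fun f g => ?_⟩
  rw [Inv_invol, ip, hl]
  exact forall₂_congr fun i _ => eq_comm

theorem Recol.refl (hC : IsCategory C) (γ : List Color) : Recol C γ γ := by
  induction γ with
  | nil => exact .nil hC
  | cons c γ ih => exact (Recol.single hC c).append hC ih

/-- Rotating both ends of `∘∘ ⊗ ••` gives two vertical lines exchanging the colors. -/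
theorem Recol.swap_black_white (hC : IsCategory C) (hg : GloballyColorized C) :
    Recol C [false, true] [true, false] := by
  have hw : Hom C [] [true, true, false, false] wwbb :=
    ⟨hg, rfl, (ofFn_sumElim _ _).trans (by simp [pairLower, mkLower, white, black])⟩
  have hcap : Hom C [false, true] [] (invol (pairLower false true)) :=
    (hom_pairLower hC false).invol hC
  have hq : Hom C [false, true] [false, true, true, false, false, true] _ :=
    (hom_idPart hC false).tensor hC (hw.tensor hC (hom_idPart hC true))
  have hp : Hom C [false, true, true, false, false, true] [true, false] _ :=
    hcap.tensor hC ((hom_idPart hC true).tensor hC ((hom_idPart hC false).tensor hC hcap))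
  obtain ⟨t, ht, it⟩ := hq.exists_comp hC hp
  refine ⟨rfl, t, ht, fun f g => ?_⟩
  rw [it]
  simp only [wwbb, Inv_tensor, Inv_idPart, Inv_invol, Inv_pairLower, idPart_k, idPart_l,
    pairLower_k, pairLower_l, invol_k, invol_l, tensor_k, tensor_l, List.length_cons,
    List.length_nil, Nat.reduceAdd, Nat.add_zero, Nat.zero_add]
  constructor
  · rintro ⟨m, ⟨h1, ⟨h2, h3⟩, h4⟩, h5, h6, h7, h8⟩ i hi
    interval_cases i
    · exact h1.trans (h5.trans (h2.trans h6))
    · exact h4.trans (h8.symm.trans (h3.symm.trans h7))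
  · intro H
    have h0 := H 0 (by omega)
    have h1 := H 1 (by omega)
    refine ⟨fun i => if i < 3 then f 0 else f 1, ?_⟩
    simp [h0, h1]

theorem Recol.of_perm (hC : IsCategory C) (hg : GloballyColorized C) (h : γ.Perm γ') :
    Recol C γ γ' := by
  induction h with
  | nil => exact .nil hC
  | cons c _ ih => exact (Recol.single hC c).append hC ih
  | trans _ _ ih ih' => exact ih.trans hC ih'
  | swap x y l =>
    refine Recol.append hC (γ := [y, x]) (γ' := [x, y]) ?_ (.refl hC l)
    cases x <;> cases y
    · exact .refl hC _
    · exact (Recol.swap_black_white hC hg).symm hC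
    · exact .swap_black_white hC hg
    · exact .refl hC _

/-- The number of white colors minus the number of black colors. -/
def csum (γ : List Color) : ℤ := γ.count true - γ.count false

theorem csum_append (γ δ : List Color) : csum (γ ++ δ) = csum γ + csum δ := by
  simp [csum]; ring

theorem csum_cons (c : Color) (γ : List Color) : csum (c :: γ) = csum [c] + csum γ :=
  csum_append [c] γ

theorem length_eq_count (γ : List Color) : γ.length = γ.count true + γ.count false :=
  (List.count_true_add_count_false γ).symm

theorem csum_map_not (γ : List Color) : csum (γ.map not) = - csum γ := by
  induction γ with
  | nil => rfl
  | cons c γ ih =>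
    rw [List.map_cons, csum_cons, ih, csum_cons c]
    cases c <;> simp [csum] <;> ring

theorem csum_modEq (γ : List Color) : csum γ % 2 = γ.length % 2 := by
  rw [csum, length_eq_count]; push_cast; omega

theorem abs_csum_singleton (c : Color) : |csum [c]| = 1 := by
  cases c <;> simp [csum]

theorem perm_of_csum (hl : γ.length = δ.length) (hc : csum γ = csum δ) : γ.Perm δ := by
  rw [length_eq_count, length_eq_count δ] at hl
  rw [List.perm_iff_count]
  rintro (_ | _) <;> unfold csum at hc <;> omega

theorem exists_csum (l : ℕ) (n : ℤ) (h : |n| ≤ l) (h2 : n % 2 = l % 2) :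
    ∃ γ : List Color, γ.length = l ∧ csum γ = n := by
  rw [abs_le] at h
  refine ⟨List.replicate ((l + n) / 2).toNat true ++ List.replicate ((l - n) / 2).toNat false,
    ?_, ?_⟩
  · simp; omega
  · simp [csum, List.count_replicate]; omega

/-- The alternating coloring `∘•∘•⋯∘•` of length `2 * n`. -/
def alt : ℕ → List Color
  | 0 => []
  | n + 1 => [true, false] ++ alt n

theorem length_alt (n : ℕ) : (alt n).length = 2 * n := by
  induction n with
  | zero => rfl
  | succ n ih => simp [alt, ih]; ring

theorem csum_alt (n : ℕ) : csum (alt n) = 0 := by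
  induction n with
  | zero => rfl
  | succ n ih => rw [alt, csum_append, ih]; simp [csum]

theorem exists_hom_alt (hC : IsCategory C) (n : ℕ) : ∃ p, Hom C [] (alt n) p := by
  induction n with
  | zero =>
    obtain ⟨-, p, hp, -⟩ := Recol.nil hC
    exact ⟨p, hp⟩
  | succ n ih =>
    obtain ⟨p, hp⟩ := ih
    exact ⟨_, (hom_pairLower hC true).tensor hC hp⟩

/-- Every element with only lower points has a counterpart of opposite color sum. -/
theorem exists_hom_neg (hC : IsCategory C) (hg : GloballyColorized C) {p : TCP}
    (hp : Hom C [] γ p) : ∃ q, Hom C [] (γ.map not) q := by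
  obtain ⟨e, he⟩ := exists_hom_alt hC γ.length
  have hperm : (alt γ.length).Perm (γ.map not ++ γ) := by
    refine perm_of_csum ?_ ?_
    · simp [length_alt]; ring
    · rw [csum_alt, csum_append, csum_map_not]; ring
  obtain ⟨-, r, hr, -⟩ := Recol.of_perm hC hg hperm
  obtain ⟨-, i, hi, -⟩ := Recol.refl hC (γ.map not)
  obtain ⟨s, hs, -⟩ := he.exists_comp hC hr
  obtain ⟨t, ht, -⟩ := hs.exists_comp hC (hi.tensor hC (hp.invol hC))
  exact ⟨t, by simpa using ht⟩

end Recolor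

section Nest

variable {C : Set TCP} {γ γ' B B' U L A : List Color} {x y x' y' : Color}

/-- `C` contains a partition without upper points, colored by `γ` followed by `x`, `B`, `y`, in
which no block meets both `γ` and the rest, and in which the points `x` and `y` are joined. -/
def Good (C : Set TCP) (γ : List Color) (x : Color) (B : List Color) (y : Color) : Prop :=
  γ ≠ [] ∧ ∃ p, Hom C [] (γ ++ x :: (B ++ [y])) p ∧ (∀ f, Inv p f (· < γ.length)) ∧
    ∀ f g, Inv p f g → g γ.length = g (γ.length + B.length + 1)

theorem Good.map (hC : IsCategory C) {T : TCP} (h : Good C γ x B y)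
    (hT : Hom C (γ ++ x :: (B ++ [y])) (γ' ++ x' :: (B' ++ [y'])) T) (hne : γ' ≠ [])
    (hs : Inv T (· < γ.length) (· < γ'.length))
    (hc : ∀ m g, Inv T m g → m γ.length = g γ'.length ∧
      m (γ.length + B.length + 1) = g (γ'.length + B'.length + 1)) : Good C γ' x' B' y' := by
  obtain ⟨-, p, hp, sep, conn⟩ := h
  obtain ⟨t, ht, it⟩ := hp.exists_comp hC hT
  refine ⟨hne, t, ht, fun f => (it _ _).2 ⟨_, sep f, hs⟩, fun f g hfg => ?_⟩
  obtain ⟨m, h1, h2⟩ := (it _ _).1 hfg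
  obtain ⟨e1, e2⟩ := hc _ _ h2
  rw [← e1, ← e2]
  exact conn _ _ h1

theorem Good.recolor (hC : IsCategory C) (hg : GloballyColorized C) (h : Good C γ x B y)
    (hγ : γ.length = γ'.length) (hB : B.length = B'.length)
    (hc : csum (γ ++ x :: (B ++ [y])) = csum (γ' ++ x' :: (B' ++ [y']))) :
    Good C γ' x' B' y' := by
  obtain ⟨-, T, hT, iT⟩ := Recol.of_perm hC hg (perm_of_csum (by simp [hγ, hB]) hc)
  refine h.map hC hT ?_ ((iT _ _).2 fun i _ => by rw [hγ]) fun m g hmg => ?_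
  · rw [← List.length_pos_iff_ne_nil, ← hγ, List.length_pos_iff_ne_nil]
    exact h.1
  · have := (iT _ _).1 hmg
    rw [← hγ, ← hB]
    exact ⟨this _ (by simp), this _ (by simp; omega)⟩

theorem Good.left (hC : IsCategory C) {t : TCP} (h : Good C (U ++ A) x B y)
    (ht : Hom C U L t) (hne : L ++ A ≠ []) : Good C (L ++ A) x B y := by
  obtain ⟨-, I, hI, iI⟩ := Recol.refl hC (A ++ x :: (B ++ [y]))
  have hT := ht.tensor hC hI
  simp only [← List.append_assoc] at hT
  simp only [List.append_assoc] at hT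
  refine h.map hC (by simpa using hT) hne ?_ fun m g hmg => ?_
  · rw [Inv_tensor, iI, ht.k_eq, ht.l_eq]
    refine ⟨Inv_of_forall (c := True) (fun i hi => ?_) (fun i hi => ?_), fun i _ => ?_⟩
    · rw [ht.k_eq] at hi
      simp; omega
    · rw [ht.l_eq] at hi
      simp; omega
    · simp
  · rw [Inv_tensor, iI, ht.k_eq, ht.l_eq] at hmg
    have h1 := hmg.2 A.length (by simp)
    have h2 := hmg.2 (A.length + B.length + 1) (by simp; omega)
    simp only [List.length_append, add_assoc] at h1 h2 ⊢
    exact ⟨h1, h2⟩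

theorem Good.right (hC : IsCategory C) {t : TCP} (h : Good C γ x (U ++ B) y)
    (ht : Hom C U L t) : Good C γ x (L ++ B) y := by
  obtain ⟨-, I, hI, iI⟩ := Recol.refl hC (γ ++ [x])
  obtain ⟨-, J, hJ, iJ⟩ := Recol.refl hC (B ++ [y])
  have hT := hI.tensor hC (ht.tensor hC hJ)
  refine h.map hC (by simpa using hT) h.1 ?_ fun m g hmg => ?_
  · rw [Inv_tensor, Inv_tensor, iI, iJ, hI.k_eq, hI.l_eq]
    refine ⟨fun i _ => rfl,
      Inv_of_forall (c := False) (fun i _ => ?_) (fun i _ => ?_), fun i _ => ?_⟩ <;>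
    · simp; try omega
  · rw [Inv_tensor, Inv_tensor, iI, iJ, hI.k_eq, hI.l_eq, ht.k_eq, ht.l_eq] at hmg
    have h1 := hmg.1 γ.length (by simp)
    have h2 := hmg.2.2 B.length (by simp)
    simp only [List.length_append, List.length_singleton] at h2 ⊢
    refine ⟨h1, ?_⟩
    convert h2 using 2 <;> ring

theorem card_eq_count {n : ℕ} (f : Fin n → Color) (c : Color) :
    Nat.card {j // f j = c} = (List.ofFn f).count c := by
  induction n with
  | zero => simp
  | succ n ih =>
    rw [List.ofFn_succ, List.count_cons, ← ih, Nat.card_eq_fintype_card,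
      Nat.card_eq_fintype_card, Fintype.card_subtype, Fintype.card_subtype,
      Fin.card_filter_univ_succ]
    simp only [beq_iff_eq]
    split_ifs <;> simp

theorem cval_eq_csum {p : TCP} (hk : p.k = 0) : cval p = csum (List.ofFn p.lowColor) := by
  obtain ⟨k, l, uc, lc, r⟩ := p
  dsimp only at hk
  subst hk
  rw [cval, card_eq_count, card_eq_count, card_eq_count, card_eq_count]
  simp [csum, white, black]

/-- The restriction of a partition to the `n` lower points starting at position `s`. -/
def lowerPart (p : TCP) (s n : ℕ) (h : s + n ≤ p.l) : TCP where
  k := 0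
  l := n
  upColor := Fin.elim0
  lowColor := fun i => p.lowColor ⟨s + i, by omega⟩
  rel := Setoid.comap (Sum.elim (fun i : Fin 0 => (Fin.elim0 i : Fin p.k ⊕ Fin p.l))
    (fun i : Fin n => .inr ⟨s + i, by omega⟩)) p.rel

theorem ofFn_lowerPart (p : TCP) (s n : ℕ) (h : s + n ≤ p.l) :
    List.ofFn (lowerPart p s n h).lowColor = ((List.ofFn p.lowColor).drop s).take n := by
  refine List.ext_getElem ?_ fun i h1 h2 => ?_
  · simp [lowerPart]; omega
  · simp [lowerPart]

theorem Inv_lowerPart (p : TCP) (s n : ℕ) (h : s + n ≤ p.l) (f g : ℕ → Prop) :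
    Inv (lowerPart p s n h) f g ↔ ∀ i j (hi : i < n) (hj : j < n),
      p.rel.r (.inr ⟨s + i, by omega⟩) (.inr ⟨s + j, by omega⟩) → g i = g j := by
  constructor
  · intro H i j hi hj hij
    exact H (.inr ⟨i, hi⟩) (.inr ⟨j, hj⟩) hij
  · rintro H (a | a) (b | b) hab
    · exact a.elim0
    · exact a.elim0
    · exact b.elim0
    · exact H a b a.2 b.2 hab

/-- Nest decomposed forms in `C` in terms of colors. -/
theorem mem_Kset_iff (hNC : ∀ p ∈ C, Noncrossing p) (n : ℤ) :
    n ∈ Kset C x y ↔ ∃ γ B, Good C γ x B y ∧ csum γ = n := by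
  constructor
  · rintro ⟨p₁, p₂, ⟨hmem, -, hk₁, hk₂, hl₁, hl₂, hx, hy, hxy⟩, hn⟩
    rw [cval_eq_csum hk₁] at hn
    obtain ⟨B, hB⟩ : ∃ B, List.ofFn p₂.lowColor = x :: (B ++ [y]) := by
      have hlen : (List.ofFn p₂.lowColor).length = p₂.l := by simp
      have hx' : (List.ofFn p₂.lowColor)[0]? = some x := by
        rw [← hx, List.getElem?_eq_getElem (by omega)]; simp
      have hy' : (List.ofFn p₂.lowColor)[p₂.l - 1]? = some y := by
        rw [← hy, List.getElem?_eq_getElem (by simp; omega)]; simp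
      revert hlen hx' hy'
      generalize List.ofFn p₂.lowColor = l
      intro hlen hx' hy'
      rcases l with _ | ⟨c, l⟩
      · simp at hx'
      · rcases List.eq_nil_or_concat l with rfl | ⟨B, d, rfl⟩
        · simp at hlen; omega
        · simp at hx' hlen
          rw [← hlen] at hy'
          simp at hy'
          exact ⟨B, by simp [hx', hy']⟩
    have hlB : p₂.l = B.length + 2 := by
      have := congrArg List.length hB
      simpa using this
    refine ⟨List.ofFn p₁.lowColor, B, ⟨?_, tensor p₁ p₂, ⟨hmem, ?_, ?_⟩, fun f => ?_,
      fun f g hfg => ?_⟩, hn⟩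
    · rw [← List.length_pos_iff_ne_nil]; simpa using hl₁
    · rw [← List.length_eq_zero_iff, List.length_ofFn]; simp [hk₁, hk₂]
    · rw [← hB]; exact ofFn_sumElim _ _
    · rw [Inv_tensor]
      refine ⟨Inv_of_forall (c := True) (fun i hi => ?_) (fun i hi => ?_),
        Inv_of_forall (c := False) (fun i hi => ?_) (fun i hi => ?_)⟩
      · omega
      · simpa using hi
      · omega
      · simp
    · have := ((Inv_tensor _ _).1 hfg).2 _ _ hxy
      simp only [label, Sum.elim_inr] at this
      rw [List.length_ofFn]
      have e : p₁.l + B.length + 1 = p₁.l + (p₂.l - 1) := by omega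
      rw [e]
      exact this
  · rintro ⟨γ, B, ⟨hne, p, hp, sep, conn⟩, hn⟩
    have hk : p.k = 0 := hp.k_eq
    have hl : p.l = γ.length + (B.length + 2) := by rw [hp.l_eq]; simp
    let p₁ := lowerPart p 0 γ.length (by omega)
    let p₂ := lowerPart p γ.length (B.length + 2) (by omega)
    have c₁ : List.ofFn p₁.lowColor = γ := by
      rw [ofFn_lowerPart, hp.low]; simp
    have c₂ : List.ofFn p₂.lowColor = x :: (B ++ [y]) := by
      rw [ofFn_lowerPart, hp.low]; simp
    have e : tensor p₁ p₂ = p := by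
      refine eq_of_Inv ?_ ?_ fun f g => ?_
      · rw [hp.up]; rfl
      · rw [hp.low]; exact (ofFn_sumElim _ _).trans (congrArg₂ _ c₁ c₂)
      · rw [Inv_tensor, Inv_lowerPart, Inv_lowerPart]
        constructor
        · rintro ⟨h1, h2⟩ (a | a) (b | b) hab
          · have := a.2; omega
          · have := a.2; omega
          · have := b.2; omega
          · have hs := iff_of_eq (sep f _ _ hab)
            simp only [label, Sum.elim_inr] at hs ⊢
            by_cases ha : a.1 < γ.length
            · refine h1 a b ha (hs.1 ha) ?_
              simpa using hab
            · have hb : ¬ b.1 < γ.length := fun hb => ha (hs.2 hb)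
              have ea : γ.length + (a.1 - γ.length) = a := by omega
              have eb : γ.length + (b.1 - γ.length) = b := by omega
              have := h2 (a - γ.length) (b - γ.length) (by omega) (by omega)
                (by simpa only [ea, eb] using hab)
              change g (γ.length + (a.1 - γ.length)) = g (γ.length + (b.1 - γ.length)) at this
              rwa [ea, eb] at this
        · intro H
          refine ⟨fun i j hi hj hij => ?_, fun i j hi hj hij => ?_⟩
          · simpa [label] using H _ _ hij
          · exact H _ _ hij
    have hne' : 0 < γ.length := List.length_pos_iff_ne_nil.2 hne
    have hmem : tensor p₁ p₂ ∈ C := e ▸ hp.mem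
    refine ⟨p₁, p₂, ⟨hmem, hNC _ hmem, rfl, rfl, hne', by simp [p₂, lowerPart], ?_, ?_, ?_⟩, ?_⟩
    · have : (List.ofFn p₂.lowColor)[0]? = some x := by rw [c₂]; rfl
      rw [List.getElem?_eq_getElem (by simp [p₂, lowerPart])] at this
      simpa using this
    · have : (List.ofFn p₂.lowColor)[B.length + 1]? = some y := by rw [c₂]; simp
      rw [List.getElem?_eq_getElem (by simp [p₂, lowerPart])] at this
      simp only [List.getElem_ofFn, Option.some.injEq] at this
      exact this
    · refine (rel_iff_Inv (p := p) (.inr ⟨γ.length + 0, by omega⟩)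
        (.inr ⟨γ.length + (B.length + 1), by omega⟩)).2 fun f g hfg => ?_
      exact conn f g hfg
    · rw [cval_eq_csum rfl, c₁, hn]

end Nest

section Degree

variable {C : Set TCP} {γ B : List Color} {x y : Color}

theorem good_two (hC : IsCategory C) : Good C [true, false] true [] false := by
  refine ⟨by simp, _, (hom_pairLower hC true).tensor hC (hom_pairLower hC true),
    fun f => ?_, fun f g hfg => ?_⟩
  · simp [Inv_tensor, Inv_pairLower]
  · simpa [Inv_tensor, Inv_pairLower] using (Inv_tensor _ _).1 hfg |>.2

/-- After padding, a nest decomposed form can be recolored arbitrarily. -/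
theorem Good.mem_Kset (hC : IsCategory C) (hNC : ∀ p ∈ C, Noncrossing p)
    (hg : GloballyColorized C) (h : Good C γ x B y) (h0 : csum (γ ++ x :: (B ++ [y])) = 0)
    (x' y' : Color) {n : ℤ} (hn : n % 2 = γ.length % 2) : n ∈ Kset C x' y' := by
  obtain ⟨p, hp⟩ := exists_hom_alt hC (n.natAbs + 2)
  have h1 := Good.left hC (U := []) h hp (by simp [h.1])
  have h2 := Good.right hC (U := []) h1 hp
  have hx := abs_csum_singleton x'
  have hy := abs_csum_singleton y'
  have mod := csum_modEq (γ ++ x :: (B ++ [y]))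
  have mx := csum_modEq [x']
  have my := csum_modEq [y']
  rw [h0] at mod
  simp only [List.length_append, List.length_cons, List.length_nil] at mod mx my
  obtain ⟨γ', lγ, cγ⟩ := exists_csum ((alt (n.natAbs + 2)) ++ γ).length n
    (by rw [abs_le, List.length_append, length_alt]; omega) (by simp [length_alt]; omega)
  obtain ⟨B', lB, cB⟩ := exists_csum ((alt (n.natAbs + 2)) ++ B).length
    (- n - csum [x'] - csum [y']) (by simp [length_alt]; grind) (by simp [length_alt]; omega)
  refine (mem_Kset_iff hNC n).2 ⟨γ', B', h2.recolor hC hg lγ.symm lB.symm ?_, cγ⟩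
  simp only [csum_append, csum_cons x (_ ++ _), csum_cons x' (_ ++ _), csum_alt, cγ, cB] at h0 ⊢
  linarith

theorem Good.exists_balanced (hC : IsCategory C) (hg : GloballyColorized C)
    (h : Good C γ x B y) :
    ∃ B', Good C γ x B' y ∧ csum (γ ++ x :: (B' ++ [y])) = 0 := by
  obtain ⟨-, p, hp, -⟩ := id h
  obtain ⟨q, hq⟩ := exists_hom_neg hC hg hp
  refine ⟨_, Good.right hC (U := []) h hq, ?_⟩
  have := csum_map_not (γ ++ x :: (B ++ [y]))
  simp only [csum_append, csum_cons x (_ ++ _)] at this ⊢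
  linarith

theorem Good.reduce_odd (hC : IsCategory C) (hg : GloballyColorized C)
    (h : Good C γ x B y) (h0 : csum (γ ++ x :: (B ++ [y])) = 0) (hodd : γ.length % 2 = 1) :
    Good C [true] true [false] false := by
  have mod := csum_modEq (γ ++ x :: (B ++ [y]))
  rw [h0] at mod
  simp only [List.length_append, List.length_cons, List.length_nil] at mod
  have h1 : Good C (alt (γ.length / 2) ++ [true]) true (alt (B.length / 2) ++ [false]) false := by
    refine h.recolor hC hg ?_ ?_ ?_
    · simp [length_alt]; omega
    · simp [length_alt]; omega
    · rw [h0]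
      simp only [csum_append, csum_cons true (_ ++ _), csum_alt]
      simp [csum]
  obtain ⟨p, hp⟩ := exists_hom_alt hC (γ.length / 2)
  obtain ⟨q, hq⟩ := exists_hom_alt hC (B.length / 2)
  exact (h1.left hC (hp.invol hC) (by simp)).right hC (hq.invol hC)

theorem Inv_pPart_one (f g : ℕ → Prop) : Inv (pPart 1) f g ↔ g 1 = g 3 := by
  constructor
  · intro H
    exact H (.inr (1 : Fin 4)) (.inr (3 : Fin 4)) rfl
  · rintro H (a | a) (b | b) hab
    · exact a.elim0
    · exact a.elim0
    · exact b.elim0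
    · change Fin 4 at a b
      fin_cases a <;> fin_cases b <;>
        first
        | rfl
        | exact H
        | exact H.symm
        | (have h : (_ : ℕ) = _ := hab; exact absurd h (by decide))

theorem ofFn_pPart_one : List.ofFn (pPart 1).lowColor = [true, true, false, false] := by
  simp [pPart, mkLower]

theorem Inv_of_lower {p : TCP} {f f' g g' : ℕ → Prop} (hk : p.k = 0) (h : Inv p f g)
    (hg : ∀ i j, g i = g j → g' i = g' j) : Inv p f' g' := by
  rintro (a | a) (b | b) hab
  · have := a.2; omega
  · have := a.2; omega
  · have := b.2; omega
  · exact hg _ _ (h _ _ hab)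

theorem pPart_one_mem_iff (hC : IsCategory C) :
    pPart 1 ∈ C ↔ Good C [true] true [false] false := by
  constructor
  · intro h
    refine ⟨by simp, pPart 1, ⟨h, rfl, ofFn_pPart_one⟩, fun f => ?_, fun f g hfg => ?_⟩
    · simp [Inv_pPart_one]
    · exact (Inv_pPart_one f g).1 hfg
  · rintro ⟨-, p, hp, sep, conn⟩
    have hcap (c : Color) : Hom C [c, !c] [] (invol (pairLower c (!c))) :=
      (hom_pairLower hC c).invol hC
    have h1 : Hom C [true, true, false, false] [true, false] _ :=
      (hom_idPart hC true).tensor hC ((hcap true).tensor hC (hom_idPart hC false))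
    obtain ⟨s, hs, is⟩ := hp.exists_comp hC h1
    have sepp (f) (a b : Prop) : Inv p f (fun i => if i = 0 then a else b) :=
      Inv_of_lower hp.k_eq (sep f) fun i j hij => by
        have : i = 0 ↔ j = 0 := by simpa using hij
        simp only [this]
    have invs (f g) : Inv s f g := by
      refine (is f g).2 ⟨_, sepp f (g 0) (g 1), ?_⟩
      simp [Inv_tensor, Inv_idPart, Inv_invol, Inv_pairLower]
    have h2 : Hom C [false] [false, true, false] _ := (hom_idPart hC false).tensor hC hs
    have h3 : Hom C [false, true, false] [false] _ := (hcap false).tensor hC (hom_idPart hC false)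
    obtain ⟨D, hD, iD⟩ := h2.exists_comp hC h3
    have invD (f g) : Inv D f g := by
      refine (iD f g).2 ⟨fun i => if i < 2 then f 0 else g 0, ?_⟩
      simp [Inv_tensor, Inv_idPart, Inv_invol, Inv_pairLower, invs]
    have h4 : Hom C [true, true, false, false] [true, true, false, false] _ :=
      (hom_idPart hC true).tensor hC ((hom_idPart hC true).tensor hC
        (hD.tensor hC (hom_idPart hC false)))
    obtain ⟨t, ht, it⟩ := hp.exists_comp hC h4
    have : t = pPart 1 := by
      refine eq_of_Inv ht.up (ht.low.trans ofFn_pPart_one.symm) fun f g => ?_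
      rw [it, Inv_pPart_one]
      simp only [Inv_tensor, Inv_idPart, idPart_k, idPart_l, hD.k_eq, hD.l_eq, invD,
        List.length_cons, List.length_nil]
      constructor
      · rintro ⟨m, hm, -, h1, -, h3⟩
        exact h1.symm.trans ((conn _ _ hm).trans h3)
      · intro H
        exact ⟨_, sepp f (g 0) (g 1), by simp [H]⟩
    exact this ▸ ht.mem

/-- All the sets `K^C(x,y)` equal `d ℤ`, where `d = 1` if `p₁ ∈ C` and `d = 2` otherwise. -/
theorem mem_Kset_iff_dvd (hC : IsCategory C) (hNC : ∀ p ∈ C, Noncrossing p)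
    (hg : GloballyColorized C) (x y : Color) (n : ℤ) :
    n ∈ Kset C x y ↔ pPart 1 ∈ C ∨ 2 ∣ n := by
  constructor
  · intro h
    obtain ⟨γ, B, hgood, hn⟩ := (mem_Kset_iff hNC n).1 h
    refine or_iff_not_imp_right.2 fun h2 => ?_
    obtain ⟨B', hB', h0⟩ := hgood.exists_balanced hC hg
    have mod := csum_modEq γ
    exact (pPart_one_mem_iff hC).2 (hB'.reduce_odd hC hg h0 (by omega))
  · intro h
    by_cases h2 : 2 ∣ n
    · refine (good_two hC).mem_Kset hC hNC hg (by simp [csum]) x y ?_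
      simp only [List.length_cons, List.length_nil]; omega
    · refine ((pPart_one_mem_iff hC).1 (h.resolve_right h2)).mem_Kset hC hNC hg
        (by simp [csum]) x y ?_
      simp only [List.length_cons, List.length_nil]; omega

theorem ddeg_eq_one (hC : IsCategory C) (hNC : ∀ p ∈ C, Noncrossing p)
    (hg : GloballyColorized C) (h : pPart 1 ∈ C) : ddeg C = 1 := by
  refine IsLeast.csInf_eq ⟨⟨one_pos, ?_⟩, fun n hn => hn.1⟩
  exact (mem_Kset_iff_dvd hC hNC hg _ _ _).2 (.inl h)

theorem ddeg_eq_two (hC : IsCategory C) (hNC : ∀ p ∈ C, Noncrossing p)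
    (hg : GloballyColorized C) (h : pPart 1 ∉ C) : ddeg C = 2 := by
  refine IsLeast.csInf_eq ⟨⟨two_pos, ?_⟩, fun n ⟨hn, hK⟩ => ?_⟩
  · exact (mem_Kset_iff_dvd hC hNC hg _ _ _).2 (.inr (by simp))
  · have := ((mem_Kset_iff_dvd hC hNC hg _ _ _).1 hK).resolve_left h
    omega

end Degree


/-- In the globally colorized case `d(C) ∈ {1,2}`, with `d(C) = 1` iff `p₁ ∈ C`, and all
four local parameter sets are `d(C)·ℤ`. -/
theorem stmt_8 (C : Set TCP) (hC : IsCategory C) (hNC : ∀ p ∈ C, Noncrossing p)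
    (hg : GloballyColorized C) :
    (ddeg C = 1 ∨ ddeg C = 2) ∧ (ddeg C = 1 ↔ pPart 1 ∈ C) ∧
    Kset C white black = {n : ℤ | (ddeg C : ℤ) ∣ n} ∧
    Kset C black white = {n : ℤ | (ddeg C : ℤ) ∣ n} ∧
    Kset C white white = {n : ℤ | (ddeg C : ℤ) ∣ n} ∧
    Kset C black black = {n : ℤ | (ddeg C : ℤ) ∣ n} := by
  by_cases h : pPart 1 ∈ C
  · have hd := ddeg_eq_one hC hNC hg h
    have hK (x y : Color) : Kset C x y = {n : ℤ | (ddeg C : ℤ) ∣ n} := by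
      ext n
      simp [mem_Kset_iff_dvd hC hNC hg, hd, h]
    exact ⟨.inl hd, iff_of_true hd h, hK _ _, hK _ _, hK _ _, hK _ _⟩
  · have hd := ddeg_eq_two hC hNC hg h
    have hK (x y : Color) : Kset C x y = {n : ℤ | (ddeg C : ℤ) ∣ n} := by
      ext n
      simp [mem_Kset_iff_dvd hC hNC hg, hd, h]
    exact ⟨.inr hd, iff_of_false (by omega) h, hK _ _, hK _ _, hK _ _, hK _ _⟩

end CTCP
end
end

section
/- Let Ψ : P°• → P be the map forgetting the colors of a two-colored partition. (a) If D ⊆ P is a category of non-colored partitions, then Ψ⁻¹(D) ⊆ P°• is a category of two-colored partitions containing the unicolored pair partition ∘∘. (b) If C ⊆ P°• is a category of two-colored partitions containing ∘∘, then Ψ(C) ⊆ P is a category of non-colored partitions and Ψ⁻¹(Ψ(C)) = C. Hence Ψ induces a one-to-one correspondence between categories of non-colored partitions and categories of two-colored partitions containing ∘∘. -/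
noncomputable section
namespace CTCP

theorem forget_tensor (p q : TCP) : forget (tensor p q) = NCP.tensor (forget p) (forget q) := by
  have hs : splitPt p q = NCP.splitPt (forget p) (forget q) := by
    funext x
    rcases x with i | j <;> rfl
  unfold NCP.tensor
  rw [← hs]
  rfl

theorem forget_comp (q p : TCP) (h : q.l = p.k) :
    forget (comp q p h) = NCP.comp (forget q) (forget p) h := by
  have he : compEmbMid q p h = NCP.compEmbMid (forget q) (forget p) h := by
    funext x
    rcases x with i | j <;> rfl
  unfold forget comp NCP.comp
  congr 3
  unfold compRel NCP.compRel
  rw [he]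
  rfl

theorem forget_pairLower (c₁ c₂ : Color) : forget (pairLower c₁ c₂) = NCP.pairN := by
  have h : Setoid.ker (Sum.elim Fin.elim0 (fun _ => 0) : Fin 0 ⊕ Fin 2 → ℕ) = ⊤ := by
    ext x y
    rcases x with i | i
    · exact i.elim0
    rcases y with j | j
    · exact j.elim0
    exact ⟨fun _ => trivial, fun _ => rfl⟩
  unfold forget pairLower mkLower NCP.pairN
  congr

theorem isCategory_preimage_forget {D : Set NCP} (hD : IsCategoryN D) :
    IsCategory (forget ⁻¹' D) where
  tensor_mem p hp q hq := by
    rw [Set.mem_preimage, forget_tensor]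
    exact hD.tensor_mem _ hp _ hq
  comp_mem q hq p hp h _ := by
    rw [Set.mem_preimage, forget_comp]
    exact hD.comp_mem _ hq _ hp h
  invol_mem p hp := hD.invol_mem _ hp
  idw_mem := hD.id_mem
  idb_mem := hD.id_mem
  pairwb_mem := by
    rw [Set.mem_preimage, forget_pairLower]
    exact hD.pair_mem
  pairbw_mem := by
    rw [Set.mem_preimage, forget_pairLower]
    exact hD.pair_mem

/-- The partition joining the `i`-th upper point to the `i`-th lower point, with arbitrary
colors. -/
def recolorId {n : ℕ} (c d : Fin n → Color) : TCP where
  k := n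
  l := n
  upColor := c
  lowColor := d
  rel := Setoid.ker (Sum.elim id id)

theorem IsCategory.recolorId_zero_mem {C : Set TCP} (hC : IsCategory C) (c d : Fin 0 → Color) :
    recolorId c d ∈ C := by
  have h := hC.comp_mem _ hC.pairwb_mem _ (hC.invol_mem _ hC.pairwb_mem) rfl (fun _ => rfl)
  convert h using 1
  unfold recolorId comp
  congr 1
  · exact Subsingleton.elim (α := Fin 0 → Color) _ _
  · exact Subsingleton.elim (α := Fin 0 → Color) _ _
  · ext x y
    rcases x with i | i <;> exact i.elim0

theorem IsCategory.recolorId_black_white_mem {C : Set TCP} (hC : IsCategory C)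
    (hw : pairLower white white ∈ C) :
    recolorId (fun _ : Fin 1 => black) (fun _ => white) ∈ C := by
  have h := hC.comp_mem _ (hC.tensor_mem _ hC.idb_mem _ hw) _
    (hC.tensor_mem _ (hC.invol_mem _ hC.pairbw_mem) _ hC.idw_mem) rfl
    (by intro j; change Fin 3 at j; fin_cases j <;> rfl)
  convert h using 1
  set q := tensor (idPart black) (pairLower white white)
  set p := tensor (invol (pairLower black white)) (idPart white)
  have hql : q.l = p.k := rfl
  have key : Relation.EqvGen (compRel q p hql)
      (Sum.inl (Sum.inl (0 : Fin 1))) (Sum.inr (0 : Fin 1)) := by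
    have h₁ : Relation.EqvGen (compRel q p hql)
        (Sum.inl (Sum.inl (0 : Fin 1))) (Sum.inl (Sum.inr (0 : Fin 3))) :=
      .rel _ _ (.inl ⟨_, _, (trivial : q.rel.r (.inl (0 : Fin 1)) (.inr (0 : Fin 3))), rfl, rfl⟩)
    have h₂ : Relation.EqvGen (compRel q p hql)
        (Sum.inl (Sum.inr (0 : Fin 3))) (Sum.inl (Sum.inr (1 : Fin 3))) :=
      .rel _ _ (.inr ⟨.inl (0 : Fin 3), .inl (1 : Fin 3),
        (rfl : (0 : ℕ) = 0), rfl, rfl⟩)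
    have h₃ : Relation.EqvGen (compRel q p hql)
        (Sum.inl (Sum.inr (1 : Fin 3))) (Sum.inl (Sum.inr (2 : Fin 3))) :=
      .rel _ _ (.inl ⟨.inr (1 : Fin 3), .inr (2 : Fin 3),
        (rfl : (0 : ℕ) = 0), rfl, rfl⟩)
    have h₄ : Relation.EqvGen (compRel q p hql)
        (Sum.inl (Sum.inr (2 : Fin 3))) (Sum.inr (0 : Fin 1)) :=
      .rel _ _ (.inr ⟨.inl (2 : Fin 3), .inr (0 : Fin 1), trivial, rfl, rfl⟩)
    exact ((h₁.trans _ _ _ h₂).trans _ _ _ h₃).trans _ _ _ h₄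
  have hrel : (Setoid.ker (Sum.elim id id) : Setoid (Fin 1 ⊕ Fin 1)) = (comp q p hql).rel := by
    ext x y
    refine ⟨fun _ => ?_, fun _ => Subsingleton.elim (α := Fin 1) _ _⟩
    rcases x with i | i <;> rcases y with j | j <;> obtain rfl := Fin.eq_zero i <;>
      obtain rfl := Fin.eq_zero j
    · exact .refl _
    · exact key
    · exact key.symm _ _
    · exact .refl _
  unfold recolorId
  rw [hrel]
  unfold comp
  congr 1
  · funext i
    obtain rfl := Fin.eq_zero i
    rfl
  · funext i
    obtain rfl := Fin.eq_zero i
    rfl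

theorem invol_recolorId {n : ℕ} (c d : Fin n → Color) :
    invol (recolorId c d) = recolorId d c := by
  unfold recolorId invol
  congr 1
  ext x y
  rcases x with i | i <;> rcases y with j | j <;> rfl

theorem idPart_eq_recolorId (c : Color) :
    idPart c = recolorId (fun _ : Fin 1 => c) (fun _ => c) := by
  unfold recolorId idPart
  congr 1
  ext x y
  exact ⟨fun _ => Subsingleton.elim (α := Fin 1) _ _, fun _ => trivial⟩

theorem IsCategory.recolorId_one_mem {C : Set TCP} (hC : IsCategory C)
    (hw : pairLower white white ∈ C) (a b : Color) :
    recolorId (fun _ : Fin 1 => a) (fun _ => b) ∈ C := by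
  have hbw := hC.recolorId_black_white_mem hw
  have hwb := hC.invol_mem _ hbw
  rw [invol_recolorId] at hwb
  have hb := hC.idb_mem
  have hww := hC.idw_mem
  rw [idPart_eq_recolorId] at hb hww
  cases a <;> cases b <;> assumption

theorem sumSetoid_ker {α β γ δ : Type*} (f : α → γ) (g : β → δ) :
    sumSetoid (Setoid.ker f) (Setoid.ker g) = Setoid.ker (Sum.map f g) := by
  ext x y
  rw [Setoid.ker_def]
  rcases x with a | a <;> rcases y with b | b
  · exact Sum.inl_injective.eq_iff.symm
  · exact ⟨False.elim, Sum.inl_ne_inr⟩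
  · exact ⟨False.elim, Sum.inr_ne_inl⟩
  · exact Sum.inr_injective.eq_iff.symm

theorem tensor_recolorId {n : ℕ} (c d : Fin (n + 1) → Color) :
    tensor (recolorId (fun i : Fin n => c i.castSucc) (fun i => d i.castSucc))
      (recolorId (fun _ : Fin 1 => c (Fin.last n)) (fun _ => d (Fin.last n))) =
    recolorId c d := by
  unfold tensor recolorId
  congr 1
  · funext i
    induction i using Fin.lastCases <;> simp
  · funext i
    induction i using Fin.lastCases <;> simp
  · ext x y
    have hsplit : ∀ z, Sum.map (Sum.elim id id) (Sum.elim id id)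
        (splitPt (recolorId (fun i : Fin n => c i.castSucc) (fun i => d i.castSucc))
          (recolorId (fun _ : Fin 1 => c (Fin.last n)) (fun _ => d (Fin.last n))) z) =
        finSumFinEquiv.symm (Sum.elim id id z : Fin (n + 1)) := by
      rintro (i | i)
      · have hs : ∀ s : Fin n ⊕ Fin 1,
            Sum.map (Sum.elim id id : Fin n ⊕ Fin n → Fin n)
              (Sum.elim id id : Fin 1 ⊕ Fin 1 → Fin 1)
              (s.elim (fun a => .inl (.inl a)) fun b => .inr (.inl b)) = s := by
          rintro (a | b) <;> rfl
        exact hs (finSumFinEquiv.symm i)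
      · have hs : ∀ s : Fin n ⊕ Fin 1,
            Sum.map (Sum.elim id id : Fin n ⊕ Fin n → Fin n)
              (Sum.elim id id : Fin 1 ⊕ Fin 1 → Fin 1)
              (s.elim (fun a => .inl (.inr a)) fun b => .inr (.inr b)) = s := by
          rintro (a | b) <;> rfl
        exact hs (finSumFinEquiv.symm i)
    change sumSetoid (Setoid.ker _) (Setoid.ker _) _ _ ↔
      (Sum.elim id id x : Fin (n + 1)) = Sum.elim id id y
    rw [sumSetoid_ker, Setoid.ker_def, ← finSumFinEquiv.symm.injective.eq_iff, ← hsplit x,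
      ← hsplit y]
    rfl

theorem IsCategory.recolorId_mem {C : Set TCP} (hC : IsCategory C)
    (hw : pairLower white white ∈ C) : ∀ {n : ℕ} (c d : Fin n → Color), recolorId c d ∈ C
  | 0, c, d => hC.recolorId_zero_mem c d
  | n + 1, c, d => by
    rw [← tensor_recolorId]
    exact hC.tensor_mem _ (hC.recolorId_mem hw _ _) _ (hC.recolorId_one_mem hw _ _)

theorem comp_recolorId (p : TCP) (c : Fin p.k → Color) :
    comp (recolorId c p.upColor) p rfl = { p with upColor := c } := by
  have hrel : (comp (recolorId c p.upColor) p rfl).rel = p.rel := by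
    ext x y
    constructor
    · intro h
      let f : (Fin p.k ⊕ Fin p.k) ⊕ Fin p.l → Fin p.k ⊕ Fin p.l :=
        Sum.map (Sum.elim id id) id
      have key : ∀ s t, Relation.EqvGen (compRel (recolorId c p.upColor) p rfl) s t →
          p.rel.r (f s) (f t) := by
        intro s t hst
        induction hst with
        | rel s t hst =>
          rcases hst with ⟨x, y, hxy, rfl, rfl⟩ | ⟨x, y, hxy, rfl, rfl⟩
          · have h' : (Sum.elim id id x : Fin p.k) = Sum.elim id id y := hxy
            change p.rel.r (.inl (Sum.elim id id x)) (.inl (Sum.elim id id y))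
            rw [h']
            exact p.rel.refl _
          · rcases x with i | i <;> rcases y with j | j <;> exact hxy
        | refl s => exact p.rel.refl _
        | symm s t _ ih => exact p.rel.symm ih
        | trans s t u _ _ ih₁ ih₂ => exact p.rel.trans ih₁ ih₂
      have := key _ _ h
      rcases x with i | i <;> rcases y with j | j <;> exact this
    · intro h
      have key : ∀ x : Fin p.k ⊕ Fin p.l,
          Relation.EqvGen (compRel (recolorId c p.upColor) p rfl)
            (Sum.elim (fun i : Fin p.k => Sum.inl (Sum.inl i)) (fun j => Sum.inr j) x)
            (compEmbMid (recolorId c p.upColor) p rfl x) := by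
        rintro (i | j)
        · exact .rel _ _ (.inl ⟨.inl i, .inr i, rfl, rfl, rfl⟩)
        · exact .refl _
      exact ((key x).trans _ _ _ (.rel _ _ (.inr ⟨x, y, h, rfl, rfl⟩))).trans _ _ _
        ((key y).symm _ _)
  rw [← hrel]
  rfl

theorem IsCategory.recolorUp_mem {C : Set TCP} (hC : IsCategory C)
    (hw : pairLower white white ∈ C) {p : TCP} (hp : p ∈ C) (c : Fin p.k → Color) :
    { p with upColor := c } ∈ C := by
  rw [← comp_recolorId]
  exact hC.comp_mem _ (hC.recolorId_mem hw _ _) _ hp rfl fun _ => rfl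

theorem invol_invol (p : TCP) : invol (invol p) = p := by
  have hrel : (invol (invol p)).rel = p.rel := by
    ext x y
    rcases x with i | i <;> rcases y with j | j <;> rfl
  obtain ⟨k, l, c, d, r⟩ := p
  unfold invol at *
  simp only at hrel
  rw [hrel]

/-- A category containing `∘∘` is closed under arbitrary changes of colors. -/
theorem IsCategory.mem_of_forget_eq {C : Set TCP} (hC : IsCategory C)
    (hw : pairLower white white ∈ C) {p q : TCP} (hp : p ∈ C) (h : forget p = forget q) :
    q ∈ C := by
  obtain ⟨k, l, c, d, r⟩ := p
  obtain ⟨k', l', c', d', r'⟩ := q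
  simp only [forget, NCP.mk.injEq] at h
  obtain ⟨rfl, rfl, h⟩ := h
  obtain rfl := eq_of_heq h
  have h₁ := hC.recolorUp_mem hw hp c'
  have h₂ := hC.invol_mem _ (hC.recolorUp_mem hw (hC.invol_mem _ h₁) d')
  have h₃ := invol_invol ⟨k, l, c', d', r⟩
  rw [← h₃]
  exact h₂

theorem isCategoryN_image_forget {C : Set TCP} (hC : IsCategory C)
    (hw : pairLower white white ∈ C) : IsCategoryN (forget '' C) where
  tensor_mem := by
    rintro _ ⟨p, hp, rfl⟩ _ ⟨q, hq, rfl⟩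
    exact ⟨_, hC.tensor_mem _ hp _ hq, forget_tensor p q⟩
  comp_mem := by
    rintro _ ⟨q, hq, rfl⟩ _ ⟨p, hp, rfl⟩ h
    refine ⟨_, hC.comp_mem _ hq _
      (hC.recolorUp_mem hw hp fun i => q.lowColor (Fin.cast h.symm i)) h fun _ => rfl, ?_⟩
    exact forget_comp _ _ _
  invol_mem := by
    rintro _ ⟨p, hp, rfl⟩
    exact ⟨_, hC.invol_mem _ hp, rfl⟩
  id_mem := ⟨_, hC.idw_mem, rfl⟩
  pair_mem := ⟨_, hw, forget_pairLower _ _⟩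

theorem forget_surjective : Function.Surjective forget :=
  fun p => ⟨⟨p.k, p.l, fun _ => white, fun _ => white, p.rel⟩, rfl⟩

theorem preimage_image_forget {C : Set TCP} (hC : IsCategory C)
    (hw : pairLower white white ∈ C) : forget ⁻¹' (forget '' C) = C := by
  refine Set.Subset.antisymm ?_ (Set.subset_preimage_image _ _)
  rintro q ⟨p, hp, h⟩
  exact hC.mem_of_forget_eq hw hp h

/-- The one-to-one correspondence, via the forgetful map `Ψ`, between categories of
non-colored partitions and categories of two-colored partitions containing `∘∘`. -/
theorem stmt_9 :
    (∀ D : Set NCP, IsCategoryN D →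
        IsCategory (forget ⁻¹' D) ∧ pairLower white white ∈ forget ⁻¹' D) ∧
    (∀ C : Set TCP, IsCategory C → pairLower white white ∈ C →
        IsCategoryN (forget '' C) ∧ forget ⁻¹' (forget '' C) = C) ∧
    (∀ C₁ C₂ : Set TCP, IsCategory C₁ → pairLower white white ∈ C₁ →
        IsCategory C₂ → pairLower white white ∈ C₂ →
        forget '' C₁ = forget '' C₂ → C₁ = C₂) ∧
    (∀ D : Set NCP, IsCategoryN D →
        ∃ C : Set TCP, IsCategory C ∧ pairLower white white ∈ C ∧ forget '' C = D) := by
  refine ⟨fun D hD => ⟨isCategory_preimage_forget hD, ?_⟩,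
    fun C hC hw => ⟨isCategoryN_image_forget hC hw, preimage_image_forget hC hw⟩,
    fun C₁ C₂ h₁ hw₁ h₂ hw₂ h => ?_,
    fun D hD => ⟨forget ⁻¹' D, isCategory_preimage_forget hD, ?_,
      Set.image_preimage_eq D forget_surjective⟩⟩
  · rw [Set.mem_preimage, forget_pairLower]
    exact hD.pair_mem
  · rw [← preimage_image_forget h₁ hw₁, h, preimage_image_forget h₂ hw₂]
  · rw [Set.mem_preimage, forget_pairLower]
    exact hD.pair_mem

end CTCP
end
end
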